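/- Let M be a II₁ factor with separable predual, trace τ, ω a free ultrafilter on ℕ, and π : M → M^ω the diagonal embedding into the tracial ultrapower. For x ∈ M and finite n ≥ 2, the following are equivalent: (a) x is a σ-strong limit of n-divisible elements of M; (b) π(x) is n-divisible in M^ω, i.e., W*(π(x))' ∩ M^ω unitally contains M_n(ℂ). -/

import Mathlib

open Filter

/-- `z` is `n`-divisible in the von Neumann algebra `M`. -/
def NDivisible {H : Type*} [NormedAddCommGroup H] [InnerProductSpace ℂ H] [CompleteSpace H]
    (M : VonNeumannAlgebra H) (n : ℕ) (z : H →L[ℂ] H) : Prop :=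
  ∃ φ : Matrix (Fin n) (Fin n) ℂ →⋆ₐ[ℂ] (H →L[ℂ] H),
    (∀ T, φ T ∈ M) ∧ ∀ T, Commute (φ T) z

/-- σ-strong convergence of a net via the ℓ²-vector seminorms. -/
def SigmaStrongTendsto {H : Type*} [NormedAddCommGroup H] [InnerProductSpace ℂ H]
    {ι : Type*} (l : Filter ι) (zs : ι → H →L[ℂ] H) (z : H →L[ℂ] H) : Prop :=
  ∀ ξ : ℕ → H, Summable (fun i => ‖ξ i‖ ^ 2) →
    Tendsto (fun α => ∑' i, ‖zs α (ξ i) - z (ξ i)‖ ^ 2) l (nhds 0)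

namespace TracialDivisibility

open scoped InnerProductSpace ComplexOrder

section Operators

variable {H : Type*} [NormedAddCommGroup H] [InnerProductSpace ℂ H] [CompleteSpace H]
  {M : VonNeumannAlgebra H}

theorem mem_of_commute {z : H →L[ℂ] H} (h : ∀ t ∈ M.commutant, Commute t z) : z ∈ M := by
  rw [← VonNeumannAlgebra.commutant_commutant M, VonNeumannAlgebra.mem_commutant_iff]
  exact fun g hg => h g hg

theorem commute_of_mem {t z : H →L[ℂ] H} (ht : t ∈ M.commutant) (hz : z ∈ M) : Commute t z :=
  (VonNeumannAlgebra.mem_commutant_iff.1 ht z hz).symm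

theorem smul_mem (c : ℂ) {z : H →L[ℂ] H} (hz : z ∈ M) : c • z ∈ M :=
  M.toStarSubalgebra.smul_mem hz c

theorem real_smul_mem (c : ℝ) {z : H →L[ℂ] H} (hz : z ∈ M) : c • z ∈ M := by
  have := smul_mem (c : ℂ) hz
  rwa [Complex.coe_smul] at this

theorem starProjection_mem (K : Submodule ℂ H) [K.HasOrthogonalProjection]
    (h : ∀ t ∈ M.commutant, ∀ ξ ∈ K, t ξ ∈ K) : K.starProjection ∈ M := by
  rw [VonNeumannAlgebra.IsStarProjection.mem_iff isStarProjection_starProjection]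
  intro t ht
  rw [Submodule.range_starProjection]
  exact fun ξ hξ => h t ht ξ hξ

theorem cfc_mem (f : ℝ → ℝ) {a : H →L[ℂ] H} (ha : a ∈ M) : cfc f a ∈ M := by
  refine mem_of_commute fun t ht => ?_
  exact (Commute.cfc_real (commute_of_mem ht ha).symm f).symm

theorem posPart_mem {a : H →L[ℂ] H} (ha : a ∈ M) : a⁺ ∈ M := by
  refine mem_of_commute fun t ht => ?_
  exact (Commute.cfcₙ_real (commute_of_mem ht ha).symm _).symm

/-- The spectral projection of `b` for `(0, ∞)` lies in `M`. -/
theorem exists_spectral_projection {b : H →L[ℂ] H} (hbM : b ∈ M) (hb : IsSelfAdjoint b) :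
    ∃ s ∈ M, IsStarProjection s ∧ Commute s b ∧ 0 ≤ s * b ∧ (1 - s) * b ≤ 0 := by
  have hK : IsClosed ((b⁺).ker : Set H) := (b⁺).isClosed_ker
  have : CompleteSpace (b⁺).ker := hK.completeSpace_coe
  have hcomm : ∀ t ∈ M.commutant, ∀ ξ ∈ (b⁺).ker, t ξ ∈ (b⁺).ker := by
    intro t ht ξ hξ
    have h := DFunLike.congr_fun (commute_of_mem ht (posPart_mem hbM)).eq ξ
    simp only [mul_apply_eq_comp] at h
    simp only [LinearMap.mem_ker, ContinuousLinearMap.coe_coe] at hξ ⊢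
    rw [← h, hξ, map_zero]
  set e := ((b⁺).ker).starProjection with he
  have heP : IsStarProjection e := isStarProjection_starProjection
  have heM : e ∈ M := starProjection_mem _ hcomm
  have h1 : b⁺ * e = 0 := by
    ext ξ
    exact ((b⁺).ker).starProjection_apply_mem ξ
  have h2 : e * b⁻ = b⁻ := by
    ext ξ
    refine Submodule.starProjection_eq_self_iff.2 ?_
    exact DFunLike.congr_fun (CFC.posPart_mul_negPart b) ξ
  have h1' : e * b⁺ = 0 := by
    have := congrArg star h1
    rwa [star_mul, heP.isSelfAdjoint.star_eq, (CFC.posPart_nonneg b).isSelfAdjoint.star_eq,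
      star_zero] at this
  have h2' : b⁻ * e = b⁻ := by
    have := congrArg star h2
    rwa [star_mul, heP.isSelfAdjoint.star_eq, (CFC.negPart_nonneg b).isSelfAdjoint.star_eq]
      at this
  have hdec : b = b⁺ - b⁻ := (CFC.posPart_sub_negPart b hb).symm
  have heb : e * b = - b⁻ := by
    calc e * b = e * (b⁺ - b⁻) := by rw [← hdec]
      _ = - b⁻ := by rw [mul_sub, h1', h2, zero_sub]
  have hbe : b * e = - b⁻ := by
    calc b * e = (b⁺ - b⁻) * e := by rw [← hdec]
      _ = - b⁻ := by rw [sub_mul, h1, h2', zero_sub]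
  refine ⟨1 - e, sub_mem (one_mem M) heM, heP.one_sub, ?_, ?_, ?_⟩
  · rw [Commute, SemiconjBy, sub_mul, mul_sub, one_mul, mul_one, heb, hbe]
  · rw [sub_mul, one_mul, heb, sub_neg_eq_add]
    nth_rewrite 1 [hdec]
    rw [sub_add_cancel]
    exact CFC.posPart_nonneg b
  · rw [sub_sub_cancel, heb]
    exact neg_nonpos.2 (CFC.negPart_nonneg b)

theorem mul_eq_self_of_star_mul_self {w s : H →L[ℂ] H} (hs : IsStarProjection s)
    (hw : star w * w = s) : w * s = w := by
  have h1 : star (w * (1 - s)) * (w * (1 - s)) = 0 := by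
    rw [star_mul, mul_assoc, ← mul_assoc (star w), hw, hs.mul_one_sub_self, mul_zero]
  have h2 := (CStarRing.star_mul_self_eq_zero_iff _).1 h1
  rw [mul_sub, mul_one, sub_eq_zero] at h2
  exact h2.symm

end Operators

section Polar

variable {H : Type*} [NormedAddCommGroup H] [InnerProductSpace ℂ H] [CompleteSpace H]
  {M : VonNeumannAlgebra H}

theorem mul_eq_zero_of_mul_eq_neg_smul {s b z : H →L[ℂ] H} {t : ℝ} (ht : 0 < t)
    (hs : IsStarProjection s) (hsb : 0 ≤ s * b) (hz : b * z = -(t • z)) : s * z = 0 := by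
  have h1 : 0 ≤ star z * (s * b) * z := star_left_conjugate_nonneg hsb z
  have h2 : star z * (s * b) * z = -(t • (star (s * z) * (s * z))) := by
    rw [star_mul, hs.isSelfAdjoint.star_eq, mul_assoc, mul_assoc s, hz, mul_neg, mul_neg,
      mul_smul_comm, mul_smul_comm]
    rw [mul_assoc (star z), ← mul_assoc s s, hs.isIdempotentElem.eq]
  rw [h2] at h1
  have h3 : t • (star (s * z) * (s * z)) = 0 :=
    le_antisymm (neg_nonneg.1 h1) (smul_nonneg ht.le (star_mul_self_nonneg _))
  exact (CStarRing.star_mul_self_eq_zero_iff _).1 ((smul_eq_zero.1 h3).resolve_left ht.ne')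

theorem exists_sqrt_inv {c : H →L[ℂ] H} (hcM : c ∈ M) {t : ℝ} (ht : 0 < t)
    (hc : t • (1 : H →L[ℂ] H) ≤ c) :
    ∃ r ∈ M, ∃ g ∈ M, 0 ≤ r ∧ IsSelfAdjoint g ∧ r * r = c ∧ g * r = 1 ∧ r * g = 1 ∧
      ∀ s, Commute c s → Commute g s := by
  have hc0 : 0 ≤ c := (smul_nonneg ht.le zero_le_one).trans hc
  have hcs : IsSelfAdjoint c := hc0.isSelfAdjoint
  have hspec : ∀ x ∈ spectrum ℝ c, t ≤ x := by
    rw [← Algebra.algebraMap_eq_smul_one] at hc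
    exact (algebraMap_le_iff_le_spectrum (hcs)).1 hc
  have hcont : ContinuousOn (fun x : ℝ => (Real.sqrt x)⁻¹) (spectrum ℝ c) := by
    refine ContinuousOn.inv₀ Real.continuous_sqrt.continuousOn fun x hx => ?_
    exact (Real.sqrt_pos.2 (ht.trans_le (hspec x hx))).ne'
  have hcont' : ContinuousOn Real.sqrt (spectrum ℝ c) := Real.continuous_sqrt.continuousOn
  refine ⟨cfc Real.sqrt c, cfc_mem _ hcM, cfc (fun x : ℝ => (Real.sqrt x)⁻¹) c, cfc_mem _ hcM,
    cfc_nonneg fun x _ => Real.sqrt_nonneg x, cfc_predicate _ _, ?_, ?_, ?_, ?_⟩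
  · rw [← cfc_mul _ _ c hcont' hcont']
    conv_rhs => rw [← cfc_id ℝ c hcs]
    exact cfc_congr fun x hx => Real.mul_self_sqrt (ht.le.trans (hspec x hx))
  · rw [← cfc_mul _ _ c hcont hcont', ← cfc_one ℝ c hcs]
    exact cfc_congr fun x hx => inv_mul_cancel₀ (Real.sqrt_pos.2 (ht.trans_le (hspec x hx))).ne'
  · rw [← cfc_mul _ _ c hcont' hcont, ← cfc_one ℝ c hcs]
    exact cfc_congr fun x hx => mul_inv_cancel₀ (Real.sqrt_pos.2 (ht.trans_le (hspec x hx))).ne'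
  · exact fun s hs => Commute.cfc_real hs _

/-- Polar decomposition of `y` cut down to the spectral subspace `{y⋆y > t}`. -/
theorem exists_polar_cut {y : H →L[ℂ] H} (hy : y ∈ M) {t : ℝ} (ht : 0 < t) :
    ∃ s ∈ M, ∃ r ∈ M, ∃ w ∈ M, IsStarProjection s ∧ (1 - s) * (star y * y - t • 1) ≤ 0 ∧
      star w * w = s ∧ 0 ≤ r ∧ r * r = (star y * y) * s + t • (1 - s) ∧ w * r = y * s ∧
      (∃ g, w = y * g) ∧ (∀ z, y * z = 0 → s * z = 0) := by
  set h := star y * y with hh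
  have hhM : h ∈ M := mul_mem (star_mem hy) hy
  have hhs : IsSelfAdjoint h := IsSelfAdjoint.star_mul_self y
  have hb : IsSelfAdjoint (h - t • (1 : H →L[ℂ] H)) :=
    hhs.sub (IsSelfAdjoint.smul (IsSelfAdjoint.all t) (IsSelfAdjoint.one _))
  obtain ⟨s, hsM, hs, hsc, hs1, hs2⟩ := exists_spectral_projection
    (sub_mem hhM (real_smul_mem t (one_mem M))) hb
  have hss := hs.isIdempotentElem.eq
  have hsh : s * h = h * s := by
    have := hsc.eq
    rw [mul_sub, sub_mul, mul_smul_comm, smul_mul_assoc, one_mul, mul_one] at this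
    exact sub_left_injective this
  set c := h * s + t • (1 - s) with hc
  have hcM : c ∈ M := add_mem (mul_mem hhM hsM) (real_smul_mem t (sub_mem (one_mem M) hsM))
  have hct : t • (1 : H →L[ℂ] H) ≤ c := by
    rw [← sub_nonneg]
    convert hs1 using 1
    rw [hc, mul_sub, mul_smul_comm, mul_one, smul_sub, hsh]
    abel
  have hcs : c * s = h * s := by
    rw [hc, add_mul, smul_mul_assoc, sub_mul, one_mul, mul_assoc, hss, sub_self, smul_zero,
      add_zero]
  have hsc' : s * c = h * s := by
    rw [hc, mul_add, mul_smul_comm, mul_sub, mul_one, ← mul_assoc, hsh, mul_assoc, hss, sub_self,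
      smul_zero, add_zero]
  obtain ⟨r, hrM, g, hgM, hr0, hgs, hrr, hgr, hrg, hgc⟩ := exists_sqrt_inv hcM ht hct
  have hgs' : g * s = s * g := hgc s (by rw [Commute, SemiconjBy, hcs, hsc'])
  have hrs : r * s = s * r := by
    calc r * s = r * s * (g * r) := by rw [hgr, mul_one]
      _ = r * (g * s) * r := by rw [hgs']; simp only [mul_assoc]
      _ = s * r := by rw [← mul_assoc, hrg, one_mul]
  refine ⟨s, hsM, r, hrM, y * g * s, mul_mem (mul_mem hy hgM) hsM, hs, hs2, ?_, hr0, hrr, ?_,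
    ⟨g * s, mul_assoc _ _ _⟩, ?_⟩
  · calc star (y * g * s) * (y * g * s) = s * g * h * (g * s) := by
          rw [star_mul, star_mul, hs.isSelfAdjoint.star_eq, hgs.star_eq, hh]
          simp only [mul_assoc]
      _ = s * g * (h * s) * g := by rw [hgs']; simp only [mul_assoc]
      _ = s * (g * r) * r * (s * g) := by rw [← hcs, ← hrr]; simp only [mul_assoc]
      _ = s * (r * g) * s := by rw [← hgs', hgr]; simp only [mul_assoc, mul_one]
      _ = s := by rw [hrg, mul_one, hss]
  · rw [mul_assoc, ← hrs, ← mul_assoc, mul_assoc y, hgr, mul_one]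
  · intro z hz
    refine mul_eq_zero_of_mul_eq_neg_smul ht hs hs1 ?_
    rw [sub_mul, smul_mul_assoc, one_mul, hh, mul_assoc, hz, mul_zero, zero_sub]

/-- A nonzero element of `M` has a nonzero partial isometry of the form `y * g` below it. -/
theorem exists_partial_isometry {y : H →L[ℂ] H} (hy : y ∈ M) (hy0 : y ≠ 0) :
    ∃ w ∈ M, w ≠ 0 ∧ w * star w * w = w ∧ (∃ g, w = y * g) ∧ (∀ z, y * z = 0 → w * z = 0) := by
  set h := star y * y with hh
  have hhs : IsSelfAdjoint h := IsSelfAdjoint.star_mul_self y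
  have hn : 0 < ‖h‖ := by
    rw [norm_pos_iff]
    exact fun h0 => hy0 ((CStarRing.star_mul_self_eq_zero_iff _).1 h0)
  obtain ⟨s, hsM, r, hrM, w, hwM, hs, hs2, hws, -, -, -, hg, hz⟩ :=
    exists_polar_cut hy (half_pos hn)
  have hw : w * s = w := mul_eq_self_of_star_mul_self hs hws
  refine ⟨w, hwM, ?_, by rw [mul_assoc, hws, hw], hg, fun z hyz => ?_⟩
  · rintro rfl
    rw [mul_zero] at hws
    rw [← hws, sub_zero, one_mul, sub_nonpos] at hs2
    have h3 : ‖h‖ ≤ ‖h‖ / 2 := by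
      have := CStarAlgebra.norm_le_norm_of_nonneg_of_le (star_mul_self_nonneg y) hs2
      refine this.trans ?_
      rw [norm_smul, Real.norm_of_nonneg (half_pos hn).le]
      exact mul_le_of_le_one_right (half_pos hn).le ContinuousLinearMap.norm_id_le
    linarith
  · rw [← hw, mul_assoc, hz z hyz, mul_zero]

end Polar

section Sum

variable {H : Type*} [NormedAddCommGroup H] [InnerProductSpace ℂ H]
  {F : Set (H →L[ℂ] H)} {V : H →L[ℂ] H}

theorem mul_sum_eq (hV : ∀ ξ, HasSum (fun a : F => (a : H →L[ℂ] H) ξ) (V ξ)) {p : H →L[ℂ] H}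
    (h : ∀ a ∈ F, p * a = a) : p * V = V := by
  ext ξ
  have h1 := (hV ξ).mapL p
  have h2 : (fun a : F => p ((a : H →L[ℂ] H) ξ)) = fun a : F => (a : H →L[ℂ] H) ξ :=
    funext fun a => DFunLike.congr_fun (h a a.2) ξ
  rw [h2] at h1
  exact h1.unique (hV ξ)

theorem sum_mul_eq (hV : ∀ ξ, HasSum (fun a : F => (a : H →L[ℂ] H) ξ) (V ξ)) {p : H →L[ℂ] H}
    (h : ∀ a ∈ F, a * p = a) : V * p = V := by
  ext ξ
  have h1 := hV (p ξ)
  have h2 : (fun a : F => (a : H →L[ℂ] H) (p ξ)) = fun a : F => (a : H →L[ℂ] H) ξ :=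
    funext fun a => DFunLike.congr_fun (h a a.2) ξ
  rw [h2] at h1
  exact h1.unique (hV ξ)

theorem mul_sum_eq_single (hV : ∀ ξ, HasSum (fun a : F => (a : H →L[ℂ] H) ξ) (V ξ))
    {a c : H →L[ℂ] H} (ha : a ∈ F) (h : ∀ b ∈ F, b ≠ a → c * b = 0) : c * V = c * a := by
  ext ξ
  have h1 := (hV ξ).mapL c
  refine h1.unique (hasSum_single (⟨a, ha⟩ : F) fun b hb => ?_)
  exact DFunLike.congr_fun (h b b.2 fun h => hb (Subtype.ext h)) ξ

theorem sum_mul_eq_single (hV : ∀ ξ, HasSum (fun a : F => (a : H →L[ℂ] H) ξ) (V ξ))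
    {a c : H →L[ℂ] H} (ha : a ∈ F) (h : ∀ b ∈ F, b ≠ a → b * c = 0) : V * c = a * c := by
  ext ξ
  refine (hV (c ξ)).unique (hasSum_single (⟨a, ha⟩ : F) fun b hb => ?_)
  exact DFunLike.congr_fun (h b b.2 fun h => hb (Subtype.ext h)) ξ

end Sum

section Families

variable {H : Type*} [NormedAddCommGroup H] [InnerProductSpace ℂ H] [CompleteSpace H]
  {M : VonNeumannAlgebra H}

/-- Two operators with orthogonal initial spaces and orthogonal ranges. -/
def StarOrtho (a b : H →L[ℂ] H) : Prop := star a * b = 0 ∧ a * star b = 0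

theorem StarOrtho.symm {a b : H →L[ℂ] H} (h : StarOrtho a b) : StarOrtho b a := by
  constructor
  · have := congrArg star h.1
    rwa [star_mul, star_star, star_zero] at this
  · have := congrArg star h.2
    rwa [star_mul, star_star, star_zero] at this

/-- A set of pairwise orthogonal partial isometries. -/
structure IsOrthoFamily (F : Set (H →L[ℂ] H)) : Prop where
  partial_isometry : ∀ a ∈ F, a * star a * a = a
  ortho : ∀ a ∈ F, ∀ b ∈ F, a ≠ b → StarOrtho a b

theorem norm_le_one_of_idempotent {a : H →L[ℂ] H} (h : IsIdempotentElem (star a * a)) :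
    ‖a‖ ≤ 1 := by
  have h1 := IsStarProjection.norm_le (star a * a) ⟨h, IsSelfAdjoint.star_mul_self a⟩
  rw [CStarRing.norm_star_mul_self] at h1
  nlinarith [norm_nonneg a]

theorem IsOrthoFamily.norm_sum_le {F : Set (H →L[ℂ] H)} (hF : IsOrthoFamily F)
    (S : Finset (H →L[ℂ] H)) (hS : ↑S ⊆ F) : ‖∑ a ∈ S, a‖ ≤ 1 := by
  refine norm_le_one_of_idempotent ?_
  have h1 : star (∑ a ∈ S, a) * (∑ a ∈ S, a) = ∑ a ∈ S, star a * a := by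
    rw [star_sum, Finset.sum_mul]
    refine Finset.sum_congr rfl fun a ha => ?_
    rw [Finset.mul_sum]
    refine Finset.sum_eq_single a (fun b hb hba => ?_) (fun h => absurd ha h)
    exact (hF.ortho a (hS ha) b (hS hb) hba.symm).1
  rw [h1, IsIdempotentElem, Finset.sum_mul]
  refine Finset.sum_congr rfl fun a ha => ?_
  rw [Finset.mul_sum, Finset.sum_eq_single a]
  · rw [mul_assoc, ← mul_assoc a, hF.partial_isometry a (hS ha)]
  · intro b hb hba
    rw [mul_assoc, ← mul_assoc a, (hF.ortho a (hS ha) b (hS hb) hba.symm).2, zero_mul, mul_zero]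
  · exact fun h => absurd ha h

theorem IsOrthoFamily.summable {F : Set (H →L[ℂ] H)} (hF : IsOrthoFamily F) (ξ : H) :
    Summable fun a : F => (a : H →L[ℂ] H) ξ := by
  have hinner : ∀ a b : F, a ≠ b → ⟪(a : H →L[ℂ] H) ξ, (b : H →L[ℂ] H) ξ⟫_ℂ = 0 := by
    intro a b hab
    have h1 := (hF.ortho a a.2 b b.2 (fun h => hab (Subtype.ext h))).1
    have h2 := DFunLike.congr_fun h1 ξ
    rw [← ContinuousLinearMap.adjoint_inner_right]
    rw [mul_apply_eq_comp, ContinuousLinearMap.star_eq_adjoint] at h2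
    rw [h2]
    exact inner_zero_right _
  have hOF : OrthogonalFamily ℂ (fun a : F => (ℂ ∙ ((a : H →L[ℂ] H) ξ) : Submodule ℂ H))
      (fun a => (ℂ ∙ ((a : H →L[ℂ] H) ξ) : Submodule ℂ H).subtypeₗᵢ) := by
    intro a b hab v w
    obtain ⟨c, hc⟩ := Submodule.mem_span_singleton.1 v.2
    obtain ⟨d, hd⟩ := Submodule.mem_span_singleton.1 w.2
    simp only [Submodule.coe_subtypeₗᵢ, Submodule.subtype_apply]
    rw [← hc, ← hd, inner_smul_left, inner_smul_right, hinner a b hab, mul_zero, mul_zero]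
  have key := hOF.summable_iff_norm_sq_summable
    (fun a => ⟨(a : H →L[ℂ] H) ξ, Submodule.mem_span_singleton_self _⟩)
  refine key.2 (summable_of_sum_le (c := ‖ξ‖ ^ 2) (fun _ => sq_nonneg _) fun S => ?_)
  have h3 := hOF.norm_sum (fun a => ⟨(a : H →L[ℂ] H) ξ, Submodule.mem_span_singleton_self _⟩) S
  simp only [Submodule.coe_subtypeₗᵢ, Submodule.subtype_apply] at h3
  rw [← h3]
  have h4 : ∑ a ∈ S, (a : H →L[ℂ] H) ξ =
      (∑ a ∈ S.map (Function.Embedding.subtype _), a) ξ := by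
    rw [Finset.sum_map, sum_apply]
    rfl
  rw [h4]
  have h5 := hF.norm_sum_le (S.map (Function.Embedding.subtype _)) (by
    intro a ha
    obtain ⟨b, -, rfl⟩ := Finset.mem_map.1 (Finset.mem_coe.1 ha)
    exact b.2)
  have h6 := ContinuousLinearMap.le_of_opNorm_le _ h5 ξ
  rw [one_mul] at h6
  gcongr

/-- An orthogonal family of partial isometries in `M` sums strongly to an element of `M`. -/
theorem IsOrthoFamily.exists_sum {F : Set (H →L[ℂ] H)} (hF : IsOrthoFamily F)
    (hFM : ∀ a ∈ F, a ∈ M) :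
    ∃ V ∈ M, ∀ ξ, HasSum (fun a : F => (a : H →L[ℂ] H) ξ) (V ξ) := by
  have hsum := fun ξ => (hF.summable ξ).hasSum
  let V₀ : H →ₗ[ℂ] H :=
    { toFun := fun ξ => ∑' a : F, (a : H →L[ℂ] H) ξ
      map_add' := fun ξ η => by
        have := (hsum ξ).add (hsum η)
        simp only [← map_add] at this
        exact this.tsum_eq
      map_smul' := fun c ξ => by
        have := (hsum ξ).const_smul c
        simp only [← map_smul] at this
        exact this.tsum_eq }
  have hbound : ∀ ξ, ‖V₀ ξ‖ ≤ 1 * ‖ξ‖ := by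
    intro ξ
    refine le_of_tendsto (hsum ξ).norm (Eventually.of_forall fun S => ?_)
    have h4 : ∑ a ∈ S, (a : H →L[ℂ] H) ξ =
        (∑ a ∈ S.map (Function.Embedding.subtype _), a) ξ := by
      rw [Finset.sum_map, sum_apply]
      rfl
    rw [h4]
    exact ContinuousLinearMap.le_of_opNorm_le _ (hF.norm_sum_le _ (by
      intro a ha
      obtain ⟨b, -, rfl⟩ := Finset.mem_map.1 (Finset.mem_coe.1 ha)
      exact b.2)) ξ
  refine ⟨V₀.mkContinuous 1 hbound, mem_of_commute fun t ht => ?_, hsum⟩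
  ext ξ
  have h1 := (hsum ξ).mapL t
  have h2 := hsum (t ξ)
  have h3 : (fun a : F => t ((a : H →L[ℂ] H) ξ)) = fun a : F => (a : H →L[ℂ] H) (t ξ) := by
    funext a
    exact DFunLike.congr_fun (commute_of_mem ht (hFM a a.2)).eq ξ
  rw [h3] at h1
  exact h1.unique h2

section Sum

variable {F : Set (H →L[ℂ] H)} {V : H →L[ℂ] H}

theorem IsOrthoFamily.star_mul_sum (hF : IsOrthoFamily F)
    (hV : ∀ ξ, HasSum (fun a : F => (a : H →L[ℂ] H) ξ) (V ξ)) {a : H →L[ℂ] H} (ha : a ∈ F) :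
    star a * V = star a * a :=
  mul_sum_eq_single hV ha fun b hb hba => (hF.ortho a ha b hb hba.symm).1

theorem IsOrthoFamily.sum_mul_star (hF : IsOrthoFamily F)
    (hV : ∀ ξ, HasSum (fun a : F => (a : H →L[ℂ] H) ξ) (V ξ)) {a : H →L[ℂ] H} (ha : a ∈ F) :
    V * star a = a * star a :=
  sum_mul_eq_single hV ha fun b hb hba => (hF.ortho b hb a ha hba).2

theorem IsOrthoFamily.mul_star_sum (hF : IsOrthoFamily F)
    (hV : ∀ ξ, HasSum (fun a : F => (a : H →L[ℂ] H) ξ) (V ξ)) {a : H →L[ℂ] H} (ha : a ∈ F) :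
    a * star V = a * star a := by
  have := congrArg star (hF.sum_mul_star hV ha)
  simpa only [star_mul, star_star] using this

theorem IsOrthoFamily.mul_star_sum_mul_sum (hF : IsOrthoFamily F)
    (hV : ∀ ξ, HasSum (fun a : F => (a : H →L[ℂ] H) ξ) (V ξ)) {a : H →L[ℂ] H} (ha : a ∈ F) :
    a * (star V * V) = a := by
  rw [← mul_assoc, hF.mul_star_sum hV ha, mul_assoc, hF.star_mul_sum hV ha, ← mul_assoc,
    hF.partial_isometry a ha]

theorem IsOrthoFamily.sum_mul_star_sum_mul (hF : IsOrthoFamily F)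
    (hV : ∀ ξ, HasSum (fun a : F => (a : H →L[ℂ] H) ξ) (V ξ)) {a : H →L[ℂ] H} (ha : a ∈ F) :
    V * star V * a = a := by
  have h : star V * a = star a * a := by
    have := congrArg star (hF.star_mul_sum hV ha)
    simpa only [star_mul, star_star] using this
  rw [mul_assoc, h, ← mul_assoc, hF.sum_mul_star hV ha, hF.partial_isometry a ha]

theorem IsOrthoFamily.sum_partial_isometry (hF : IsOrthoFamily F)
    (hV : ∀ ξ, HasSum (fun a : F => (a : H →L[ℂ] H) ξ) (V ξ)) : V * star V * V = V :=
  mul_sum_eq hV fun _ ha => hF.sum_mul_star_sum_mul hV ha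

end Sum

/-- Exhaustion: there is a maximal orthogonal family of partial isometries in `M` satisfying `Q`
whose finite sums all satisfy `R`. -/
theorem exists_maximal_family (Q : (H →L[ℂ] H) → Prop)
    (hQ : ∀ a, Q a → a ∈ M ∧ a * star a * a = a) (R : (H →L[ℂ] H) → Prop) (hR : R 0) :
    ∃ F : Set (H →L[ℂ] H), ∃ V ∈ M, IsOrthoFamily F ∧
      (∀ ξ, HasSum (fun a : F => (a : H →L[ℂ] H) ξ) (V ξ)) ∧ (∀ a ∈ F, Q a) ∧
      (∀ S : Finset (H →L[ℂ] H), ↑S ⊆ F → R (∑ a ∈ S, a)) ∧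
      ∀ w, Q w → (∀ a ∈ F, StarOrtho w a) →
        (∀ S : Finset (H →L[ℂ] H), ↑S ⊆ F → R (w + ∑ a ∈ S, a)) → w ∈ F := by
  classical
  obtain ⟨F, hF⟩ := zorn_subset {F : Set (H →L[ℂ] H) | (∀ a ∈ F, Q a) ∧
      (∀ a ∈ F, ∀ b ∈ F, a ≠ b → StarOrtho a b) ∧
      ∀ S : Finset (H →L[ℂ] H), ↑S ⊆ F → R (∑ a ∈ S, a)} (by
    intro c hc hchain
    rcases c.eq_empty_or_nonempty with rfl | hne
    · refine ⟨∅, ⟨by simp, by simp, fun S hS => ?_⟩, by simp⟩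
      rw [Finset.coe_eq_empty.1 (Set.subset_empty_iff.1 hS), Finset.sum_empty]
      exact hR
    · refine ⟨⋃₀ c, ⟨?_, ?_, ?_⟩, fun s hs => Set.subset_sUnion_of_mem hs⟩
      · rintro a ⟨s, hs, ha⟩
        exact (hc hs).1 a ha
      · rintro a ⟨s, hs, ha⟩ b ⟨s', hs', hb⟩ hab
        rcases hchain.total hs hs' with h | h
        · exact (hc hs').2.1 a (h ha) b hb hab
        · exact (hc hs).2.1 a ha b (h hb) hab
      · intro S hS
        obtain ⟨s, hs, hSs⟩ := DirectedOn.exists_mem_subset_of_finset_subset_biUnion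
          (f := id) hne hchain.directedOn (s := S) (by simpa [Set.sUnion_eq_biUnion] using hS)
        exact (hc hs).2.2 S hSs)
  obtain ⟨⟨h1, h2, h3⟩, hmax⟩ := hF
  have hOF : IsOrthoFamily F := ⟨fun a ha => (hQ a (h1 a ha)).2, h2⟩
  obtain ⟨V, hVM, hV⟩ := hOF.exists_sum fun a ha => (hQ a (h1 a ha)).1
  refine ⟨F, V, hVM, hOF, hV, h1, h3, fun w hw hwo hwR => ?_⟩
  refine hmax (y := insert w F) ⟨?_, ?_, ?_⟩ (Set.subset_insert w F) (Set.mem_insert w F)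
  · rintro a (rfl | ha)
    exacts [hw, h1 a ha]
  · rintro a (rfl | ha) b (rfl | hb) hab
    exacts [absurd rfl hab, hwo b hb, (hwo a ha).symm, h2 a ha b hb hab]
  · intro S hS
    by_cases hwS : w ∈ S
    · rw [← Finset.add_sum_erase S (fun a => a) hwS]
      refine hwR _ fun a ha => ?_
      rw [Finset.mem_coe, Finset.mem_erase] at ha
      exact (hS ha.2).resolve_left ha.1
    · exact h3 S fun a ha => (hS ha).resolve_left fun h => hwS (h ▸ ha)

end Families

section Factor

variable {H : Type*} [NormedAddCommGroup H] [InnerProductSpace ℂ H] [CompleteSpace H]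

/-- The centre of `M` is trivial. -/
def IsFactor (M : VonNeumannAlgebra H) : Prop :=
  ∀ z ∈ M, (∀ m ∈ M, Commute z m) → ∃ c : ℂ, z = c • (1 : H →L[ℂ] H)

variable {M : VonNeumannAlgebra H}

theorem IsFactor.eq_bot_or_top (hM : IsFactor M) (K : Submodule ℂ H)
    (hK : IsClosed (K : Set H)) (h1 : ∀ t ∈ M, ∀ ξ ∈ K, t ξ ∈ K)
    (h2 : ∀ t ∈ M.commutant, ∀ ξ ∈ K, t ξ ∈ K) : K = ⊥ ∨ K = ⊤ := by
  have : CompleteSpace K := hK.completeSpace_coe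
  have hz : K.starProjection ∈ M := starProjection_mem K h2
  have hz' : K.starProjection ∈ M.commutant :=
    starProjection_mem K (by rwa [VonNeumannAlgebra.commutant_commutant])
  obtain ⟨c, hc⟩ := hM _ hz fun m hm => commute_of_mem hz' hm
  by_cases hc0 : c = 0
  · left
    rw [eq_bot_iff]
    intro ξ hξ
    rw [← Submodule.starProjection_eq_self_iff, hc, hc0, zero_smul] at hξ
    exact hξ.symm
  · right
    rw [eq_top_iff]
    intro ξ _
    have h3 := K.starProjection_apply_mem (c⁻¹ • ξ)
    rw [hc] at h3
    simpa [smul_smul, mul_inv_cancel₀ hc0, inv_mul_cancel₀ hc0] using h3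

theorem IsFactor.exists_mul_mul_ne_zero (hM : IsFactor M) {p q : H →L[ℂ] H}
    (hp : p ≠ 0) (hq : q ≠ 0) (hqM : q ∈ M) : ∃ m ∈ M, q * m * p ≠ 0 := by
  by_contra! hcon
  let K : Submodule ℂ H := ⨅ m : M, (q * (m : H →L[ℂ] H)).ker
  have hmem : ∀ ξ, ξ ∈ K ↔ ∀ m ∈ M, q (m ξ) = 0 := by
    intro ξ
    simp only [K, Submodule.mem_iInf, LinearMap.mem_ker]
    exact ⟨fun h m hm => h ⟨m, hm⟩, fun h m => h m m.2⟩
  have hcl : IsClosed (K : Set H) := by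
    simp only [K, Submodule.coe_iInf]
    exact isClosed_iInter fun m => (q * (m : H →L[ℂ] H)).isClosed_ker
  have h1 : ∀ t ∈ M, ∀ ξ ∈ K, t ξ ∈ K := fun t ht ξ hξ =>
    (hmem _).2 fun m hm => (hmem ξ).1 hξ (m * t) (mul_mem hm ht)
  have h2 : ∀ t ∈ M.commutant, ∀ ξ ∈ K, t ξ ∈ K := by
    intro t ht ξ hξ
    refine (hmem _).2 fun m hm => ?_
    have h1 := DFunLike.congr_fun (commute_of_mem ht (mul_mem hqM hm)).eq ξ
    simp only [mul_apply_eq_comp] at h1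
    rw [← h1, (hmem ξ).1 hξ m hm, map_zero]
  rcases hM.eq_bot_or_top K hcl h1 h2 with h | h
  · refine hp (ContinuousLinearMap.ext fun ξ => ?_)
    have : p ξ ∈ K := (hmem _).2 fun m hm => DFunLike.congr_fun (hcon m hm) ξ
    rw [h] at this
    exact this
  · refine hq (ContinuousLinearMap.ext fun ξ => ?_)
    have : ξ ∈ K := h ▸ Submodule.mem_top
    exact (hmem ξ).1 this 1 (one_mem M)

/-- Comparison of projections in a factor. -/
theorem IsFactor.comparison (hM : IsFactor M) {p q : H →L[ℂ] H} (hpM : p ∈ M) (hqM : q ∈ M)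
    (hp : IsStarProjection p) (hq : IsStarProjection q) :
    ∃ v ∈ M, v * star v * v = v ∧ q * v = v ∧ v * p = v ∧ (star v * v = p ∨ v * star v = q) := by
  obtain ⟨F, V, hVM, hF, hV, hFQ, -, hmax⟩ := exists_maximal_family (M := M)
    (fun a => a ∈ M ∧ a * star a * a = a ∧ q * a = a ∧ a * p = a)
    (fun a ha => ⟨ha.1, ha.2.1⟩) (fun _ => True) trivial
  have hqV : q * V = V := mul_sum_eq hV fun a ha => (hFQ a ha).2.2.1
  have hVp : V * p = V := sum_mul_eq hV fun a ha => (hFQ a ha).2.2.2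
  refine ⟨V, hVM, hF.sum_partial_isometry hV, hqV, hVp, ?_⟩
  by_contra! hne
  have hp'M : p - star V * V ∈ M := sub_mem hpM (mul_mem (star_mem hVM) hVM)
  have hq'M : q - V * star V ∈ M := sub_mem hqM (mul_mem hVM (star_mem hVM))
  obtain ⟨m, hm, hm0⟩ := hM.exists_mul_mul_ne_zero (sub_ne_zero.2 hne.1.symm)
    (sub_ne_zero.2 hne.2.symm) hq'M
  obtain ⟨w, hwM, hw0, hww, ⟨g, hg⟩, hwz⟩ :=
    exists_partial_isometry (mul_mem (mul_mem hq'M hm) hp'M) hm0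
  have hpV : p * star V = star V := by
    simpa only [star_mul, hp.isSelfAdjoint.star_eq] using congrArg star hVp
  have hVq : star V * q = star V := by
    simpa only [star_mul, hq.isSelfAdjoint.star_eq] using congrArg star hqV
  have hpi := hF.sum_partial_isometry hV
  have hqw : q * w = w := by
    have h1 : q * (q - V * star V) = q - V * star V := by
      rw [mul_sub, hq.isIdempotentElem.eq, ← mul_assoc q V, hqV]
    rw [hg, ← mul_assoc, ← mul_assoc, ← mul_assoc, h1]
  have hwp : w * p = w := by
    have h1 : w * (1 - p) = 0 := hwz _ (by
      have h2 : (p - star V * V) * (1 - p) = 0 := by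
        rw [sub_mul, hp.mul_one_sub_self, mul_sub, mul_one, mul_assoc, hVp, sub_self, sub_zero]
      rw [mul_assoc, h2, mul_zero])
    rw [mul_sub, mul_one, sub_eq_zero] at h1
    exact h1.symm
  have hVw : star V * w = 0 := by
    have h1 : star V * (V * star V) = star V := by
      simpa only [star_mul, star_star, mul_assoc] using congrArg star hpi
    have h2 : star V * (q - V * star V) = 0 := by rw [mul_sub, hVq, h1, sub_self]
    rw [hg, ← mul_assoc, ← mul_assoc, ← mul_assoc, h2, zero_mul, zero_mul, zero_mul]
  have hwV : w * star V = 0 := hwz _ (by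
    have : star V * V * star V = star V := by
      simpa only [star_mul, star_star, mul_assoc] using congrArg star hpi
    have h2 : (p - star V * V) * star V = 0 := by rw [sub_mul, this, hpV, sub_self]
    rw [mul_assoc, h2, mul_zero])
  have hwF : w ∈ F := by
    refine hmax w ⟨hwM, hww, hqw, hwp⟩ (fun a ha => ⟨?_, ?_⟩) fun _ _ => trivial
    · have : star w * a = star w * V * (star V * a) := by
        rw [mul_assoc, ← mul_assoc V, hF.sum_mul_star_sum_mul hV ha]
      have h2 : star w * V = 0 := by
        simpa only [star_mul, star_star, star_zero] using congrArg star hVw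
      rw [this, h2, zero_mul]
    · have : star a = star V * (V * star a) := by
        have := congrArg star (hF.mul_star_sum_mul_sum hV ha)
        simpa only [star_mul, star_star, mul_assoc] using this.symm
      rw [this, ← mul_assoc, hwV, zero_mul]
  have h5 := hF.mul_star_sum hV hwF
  rw [hwV] at h5
  rw [← h5, zero_mul] at hww
  exact hw0 hww.symm

end Factor

section PartialSums

variable {H : Type*} [NormedAddCommGroup H] [InnerProductSpace ℂ H]

/-- The finite partial sums of an orthogonal family converge strongly to its sum. -/
theorem tendsto_sum_sub {F : Set (H →L[ℂ] H)} {V : H →L[ℂ] H}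
    (hV : ∀ ξ, HasSum (fun a : F => (a : H →L[ℂ] H) ξ) (V ξ)) (ξ : H) :
    Tendsto (fun S : Finset F => ‖(V - ∑ a ∈ S.map (Function.Embedding.subtype _), a) ξ‖ ^ 2)
      atTop (nhds 0) := by
  have h1 : Tendsto (fun S : Finset F => V ξ - ∑ a ∈ S, (a : H →L[ℂ] H) ξ) atTop (nhds 0) := by
    have := (tendsto_const_nhds (x := V ξ)).sub (hV ξ)
    rwa [sub_self] at this
  have h2 := (h1.norm).pow 2
  rw [norm_zero, zero_pow two_ne_zero] at h2
  refine h2.congr fun S => ?_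
  rw [sub_apply, Finset.sum_map, sum_apply]
  rfl

theorem map_subtype_subset {F : Set (H →L[ℂ] H)} (S : Finset F) :
    ((S.map (Function.Embedding.subtype (· ∈ F)) : Finset (H →L[ℂ] H)) : Set (H →L[ℂ] H)) ⊆ F := by
  intro a ha
  obtain ⟨b, -, rfl⟩ := Finset.mem_map.1 (Finset.mem_coe.1 ha)
  exact b.2

end PartialSums

section RadonNikodym

variable {H : Type*} [NormedAddCommGroup H] [InnerProductSpace ℂ H] [CompleteSpace H]
  {M : VonNeumannAlgebra H}

theorem isStarProjection_sub {p q : H →L[ℂ] H} (hp : IsStarProjection p)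
    (hq : IsStarProjection q) (h : q * p = q) : IsStarProjection (p - q) := by
  have h' : p * q = q := by
    simpa only [star_mul, hp.isSelfAdjoint.star_eq, hq.isSelfAdjoint.star_eq] using congrArg star h
  refine ⟨?_, hp.isSelfAdjoint.sub hq.isSelfAdjoint⟩
  rw [IsIdempotentElem, sub_mul, mul_sub, mul_sub, h, h', hp.isIdempotentElem.eq,
    hq.isIdempotentElem.eq, sub_self, sub_zero]

/-- One dyadic step: a positive contraction `h` supported under `q` is the mean of a projection and
a positive contraction, both supported under `q`. -/
theorem exists_dyadic_step {q h : H →L[ℂ] H} (hh : h ∈ M) (h0 : 0 ≤ h)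
    (h1 : h ≤ 1) (hz : h * (1 - q) = 0) :
    ∃ s ∈ M, IsStarProjection s ∧ s * (1 - q) = 0 ∧ 0 ≤ (2 : ℝ) • h - s ∧ (2 : ℝ) • h - s ≤ 1 := by
  obtain ⟨s, hsM, hs, hsc, hs1, hs2⟩ := exists_spectral_projection
    (sub_mem hh (real_smul_mem (1 / 2) (one_mem M)))
    (h0.isSelfAdjoint.sub
      (IsSelfAdjoint.smul (IsSelfAdjoint.all (1 / 2 : ℝ)) (IsSelfAdjoint.one _)))
  have hss := hs.isIdempotentElem.eq
  have hsh : s * h = h * s := by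
    have := hsc.eq
    rw [mul_sub, sub_mul, mul_smul_comm, smul_mul_assoc, one_mul, mul_one] at this
    exact sub_left_injective this
  refine ⟨s, hsM, hs, mul_eq_zero_of_mul_eq_neg_smul (t := 1 / 2) (by norm_num) hs hs1 ?_, ?_, ?_⟩
  · rw [sub_mul, hz, smul_mul_assoc, one_mul, zero_sub]
  · have h3 : 0 ≤ (1 - s) * h * (1 - s) := hs.one_sub.isSelfAdjoint.conjugate_nonneg h0
    have h4 : (1 - s) * h * (1 - s) = h - s * h := by
      rw [sub_mul, one_mul, mul_sub, mul_one, sub_mul, mul_assoc, ← hsh, ← mul_assoc, hss]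
      abel
    have h5 : (2 : ℝ) • h - s = (2 : ℝ) • (s * (h - (1 / 2 : ℝ) • 1)) +
        (2 : ℝ) • (h - s * h) := by
      rw [mul_sub, mul_smul_comm, mul_one]
      module
    rw [h5, ← h4]
    exact add_nonneg (smul_nonneg zero_le_two hs1) (smul_nonneg zero_le_two h3)
  · have h3 : 0 ≤ s * (1 - h) * s := hs.isSelfAdjoint.conjugate_nonneg (sub_nonneg.2 h1)
    have h4 : s * (1 - h) * s = s - s * h := by
      rw [mul_sub, mul_one, sub_mul, hss, mul_assoc, ← hsh, ← mul_assoc, hss]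
    rw [← sub_nonneg]
    have h5 : 1 - ((2 : ℝ) • h - s) = (2 : ℝ) • (s - s * h) +
        (2 : ℝ) • (-((1 - s) * (h - (1 / 2 : ℝ) • 1))) := by
      rw [sub_mul, mul_sub s, one_mul, mul_smul_comm, mul_one]
      module
    rw [h5, ← h4]
    exact add_nonneg (smul_nonneg zero_le_two h3) (smul_nonneg zero_le_two (neg_nonneg.2 hs2))

theorem le_of_le_on_projections {f g : (H →L[ℂ] H) →ₗ[ℝ] ℝ} (hf : ∀ h ∈ M, 0 ≤ h → 0 ≤ f h)
    (hg : ∀ h ∈ M, 0 ≤ h → 0 ≤ g h) {q : H →L[ℂ] H}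
    (hq : ∀ s ∈ M, IsStarProjection s → s * (1 - q) = 0 → f s ≤ g s) {h : H →L[ℂ] H}
    (hh : h ∈ M) (h0 : 0 ≤ h) (hz : h * (1 - q) = 0) : f h ≤ g h := by
  have key : ∀ N : ℕ, ∀ h ∈ M, 0 ≤ h → h ≤ 1 → h * (1 - q) = 0 →
      f h ≤ g h + (1 / 2) ^ N * f 1 := by
    intro N
    induction N with
    | zero =>
      intro h hh h0 h1 _
      have h2 := hf (1 - h) (sub_mem (one_mem M) hh) (sub_nonneg.2 h1)
      have h3 := hg h hh h0
      rw [map_sub] at h2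
      simp only [pow_zero, one_mul]
      linarith
    | succ N ih =>
      intro h hh h0 h1 hz
      obtain ⟨s, hsM, hs, hsq, h2, h3⟩ := exists_dyadic_step hh h0 h1 hz
      have h4 := ih _ (sub_mem (real_smul_mem 2 hh) hsM) h2 h3 (by
        rw [sub_mul, smul_mul_assoc, hz, hsq, smul_zero, sub_zero])
      have h5 := hq s hsM hs hsq
      rw [map_sub, map_sub, map_smul, map_smul, smul_eq_mul, smul_eq_mul] at h4
      rw [pow_succ]
      linarith
  have key' : ∀ h ∈ M, 0 ≤ h → h ≤ 1 → h * (1 - q) = 0 → f h ≤ g h := by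
    intro h hh h0 h1 hz
    have ht : Tendsto (fun N : ℕ => g h + (1 / 2 : ℝ) ^ N * f 1) atTop (nhds (g h + 0 * f 1)) :=
      ((tendsto_pow_atTop_nhds_zero_of_lt_one (by norm_num) (by norm_num)).mul_const _).const_add _
    rw [zero_mul, add_zero] at ht
    exact ge_of_tendsto' ht fun N => key N h hh h0 h1 hz
  have hc : 0 < ‖h‖ + 1 := by positivity
  have h1 : (‖h‖ + 1)⁻¹ • h ≤ 1 := by
    have h2 : h ≤ (‖h‖ + 1) • (1 : H →L[ℂ] H) := by
      refine (IsSelfAdjoint.le_algebraMap_norm_self h0.isSelfAdjoint).trans ?_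
      rw [Algebra.algebraMap_eq_smul_one]
      exact smul_le_smul_of_nonneg_right (by linarith) zero_le_one
    have h3 := smul_le_smul_of_nonneg_left h2 (inv_nonneg.2 hc.le)
    rwa [smul_smul, inv_mul_cancel₀ hc.ne', one_smul] at h3
  have h2 := key' _ (real_smul_mem _ hh) (smul_nonneg (inv_nonneg.2 hc.le) h0) h1 (by
    rw [smul_mul_assoc, hz, smul_zero])
  rw [map_smul, map_smul] at h2
  exact le_of_smul_le_smul_left h2 (inv_pos.2 hc)

theorem IsOrthoFamily.isStarProjection_sum {F : Set (H →L[ℂ] H)} {V : H →L[ℂ] H}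
    (hF : IsOrthoFamily F) (hV : ∀ ξ, HasSum (fun a : F => (a : H →L[ℂ] H) ξ) (V ξ))
    (hP : ∀ a ∈ F, IsStarProjection a) :
    IsStarProjection V ∧ ∀ a ∈ F, V * a = a := by
  have h1 : ∀ a ∈ F, V * a = a := by
    intro a ha
    have := hF.sum_mul_star hV ha
    rwa [(hP a ha).isSelfAdjoint.star_eq, (hP a ha).isIdempotentElem.eq] at this
  have h2 : V * star V = V := sum_mul_eq hV fun a ha => by
    rw [hF.mul_star_sum hV ha, (hP a ha).isSelfAdjoint.star_eq, (hP a ha).isIdempotentElem.eq]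
  refine ⟨⟨mul_sum_eq hV h1, ?_⟩, h1⟩
  rw [← h2]
  exact IsSelfAdjoint.mul_star_self V

theorem IsOrthoFamily.isStarProjection_finset_sum {F : Set (H →L[ℂ] H)}
    (hF : IsOrthoFamily F) (hP : ∀ a ∈ F, IsStarProjection a)
    (S : Finset (H →L[ℂ] H)) (hS : ↑S ⊆ F) : IsStarProjection (∑ a ∈ S, a) := by
  refine ⟨?_, ?_⟩
  · rw [IsIdempotentElem, Finset.sum_mul]
    refine Finset.sum_congr rfl fun a ha => ?_
    rw [Finset.mul_sum, Finset.sum_eq_single a]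
    · exact (hP a (hS ha)).isIdempotentElem.eq
    · intro b hb hba
      have := (hF.ortho a (hS ha) b (hS hb) hba.symm).1
      rwa [(hP a (hS ha)).isSelfAdjoint.star_eq] at this
    · exact fun h => absurd ha h
  · rw [IsSelfAdjoint, star_sum]
    exact Finset.sum_congr rfl fun a ha => (hP a (hS ha)).isSelfAdjoint.star_eq

/-- A Radon–Nikodym type statement: if `g` is dominated by a vector functional on projections and
`f p < g p` then `f ≤ g` on some nonzero corner below `p`. -/
theorem exists_projection_le {f g : (H →L[ℂ] H) →ₗ[ℝ] ℝ} (hf : ∀ h ∈ M, 0 ≤ h → 0 ≤ f h)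
    (hg : ∀ h ∈ M, 0 ≤ h → 0 ≤ g h) {p : H →L[ℂ] H} (hpM : p ∈ M) (hp : IsStarProjection p)
    {ξ : H} (hgξ : ∀ s ∈ M, IsStarProjection s → s * p = s → g s ≤ ‖s ξ‖ ^ 2) (hfg : f p < g p) :
    ∃ q ∈ M, IsStarProjection q ∧ q * p = q ∧ q ≠ 0 ∧
      ∀ h ∈ M, 0 ≤ h → h * (1 - q) = 0 → f h ≤ g h := by
  obtain ⟨F, V, hVM, hF, hV, hFQ, -, hmax⟩ := exists_maximal_family (M := M)
    (fun r => r ∈ M ∧ IsStarProjection r ∧ r * p = r ∧ g r < f r)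
    (fun r hr => ⟨hr.1, by rw [hr.2.1.isSelfAdjoint.star_eq, hr.2.1.isIdempotentElem.eq,
      hr.2.1.isIdempotentElem.eq]⟩) (fun _ => True) trivial
  have hP : ∀ a ∈ F, IsStarProjection a := fun a ha => (hFQ a ha).2.1
  obtain ⟨hVP, hVa⟩ := hF.isStarProjection_sum hV hP
  have hVp : V * p = V := sum_mul_eq hV fun a ha => (hFQ a ha).2.2.1
  have hpV : p * V = V := by
    simpa only [star_mul, hp.isSelfAdjoint.star_eq, hVP.isSelfAdjoint.star_eq]
      using congrArg star hVp
  have hgV : g V ≤ f V := by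
    have ht := (tendsto_sum_sub hV ξ).const_add (f V)
    rw [add_zero] at ht
    refine ge_of_tendsto' ht fun S => ?_
    set S' := S.map (Function.Embedding.subtype (· ∈ F)) with hS'
    have hS : (S' : Set (H →L[ℂ] H)) ⊆ F := map_subtype_subset S
    have h1 : IsStarProjection (∑ a ∈ S', a) := hF.isStarProjection_finset_sum hP S' hS
    have h2 : (∑ a ∈ S', a) * V = ∑ a ∈ S', a := by
      have : V * (∑ a ∈ S', a) = ∑ a ∈ S', a := by
        rw [Finset.mul_sum]
        exact Finset.sum_congr rfl fun a ha => hVa a (hS ha)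
      simpa only [star_mul, h1.isSelfAdjoint.star_eq, hVP.isSelfAdjoint.star_eq]
        using congrArg star this
    have h3 : IsStarProjection (V - ∑ a ∈ S', a) := isStarProjection_sub hVP h1 h2
    have h4 : ∑ a ∈ S', a ∈ M := sum_mem fun a ha => (hFQ a (hS ha)).1
    have h5 := hgξ _ (sub_mem hVM h4) h3 (by
      rw [sub_mul, hVp, Finset.sum_mul]
      exact congrArg _ (Finset.sum_congr rfl fun a ha => (hFQ a (hS ha)).2.2.1))
    have h6 := hf _ (sub_mem hVM h4) h3.nonneg
    have h7 : g (∑ a ∈ S', a) ≤ f (∑ a ∈ S', a) := by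
      rw [map_sum, map_sum]
      exact Finset.sum_le_sum fun a ha => (hFQ a (hS ha)).2.2.2.le
    rw [map_sub] at h5 h6
    linarith
  refine ⟨p - V, sub_mem hpM hVM, isStarProjection_sub hp hVP hVp, ?_, ?_, ?_⟩
  · rw [sub_mul, hp.isIdempotentElem.eq, hVp]
  · intro h
    rw [sub_eq_zero.1 h] at hfg
    exact hfg.not_ge hgV
  · refine fun h hh h0 hz => le_of_le_on_projections hf hg (fun s hsM hs hsq => ?_) hh h0 hz
    by_contra! hlt
    have hsq' : s * (p - V) = s := by
      rw [mul_sub, mul_one, sub_eq_zero] at hsq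
      exact hsq.symm
    have hsp : s * p = s := by
      rw [← hsq', mul_assoc, sub_mul, hp.isIdempotentElem.eq, hVp]
    have hsa : ∀ a ∈ F, s * a = 0 := by
      intro a ha
      have h1 : p * a = a := by rw [← hVa a ha, ← mul_assoc, hpV]
      rw [← hsq', mul_assoc, sub_mul, h1, hVa a ha, sub_self, mul_zero]
    have hsF : s ∈ F := hmax s ⟨hsM, hs, hsp, hlt⟩ (fun a ha => by
      rw [StarOrtho, hs.isSelfAdjoint.star_eq, (hP a ha).isSelfAdjoint.star_eq, hsa a ha]
      exact ⟨rfl, rfl⟩) fun _ _ => trivial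
    have h2 := hsa s hsF
    rw [hs.isIdempotentElem.eq] at h2
    rw [h2, map_zero, map_zero] at hlt
    exact hlt.false

end RadonNikodym

section VectorFunctional

variable {H : Type*} [NormedAddCommGroup H] [InnerProductSpace ℂ H]

/-- The functional `h ↦ Re ⟪h ξ, ξ⟫`. -/
noncomputable def vectorFunctional (ξ : H) : (H →L[ℂ] H) →ₗ[ℝ] ℝ where
  toFun h := (⟪h ξ, ξ⟫_ℂ).re
  map_add' a b := by rw [add_apply, inner_add_left, Complex.add_re]
  map_smul' c a := by
    rw [← Complex.coe_smul, smul_apply, inner_smul_left]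
    simp

theorem vectorFunctional_apply (ξ : H) (h : H →L[ℂ] H) :
    vectorFunctional ξ h = (⟪h ξ, ξ⟫_ℂ).re := rfl

theorem exists_one_lt_norm_sq [Nontrivial H] : ∃ η : H, 1 < ‖η‖ ^ 2 := by
  obtain ⟨η, hη⟩ := NormedSpace.exists_lt_norm ℂ H 1
  exact ⟨η, by nlinarith⟩

end VectorFunctional

section Trace

variable {H : Type*} [NormedAddCommGroup H] [InnerProductSpace ℂ H] [CompleteSpace H]

/-- The real part of a faithful tracial state on `M`. -/
structure IsTrace (M : VonNeumannAlgebra H) (T : (H →L[ℂ] H) →ₗ[ℝ] ℝ) : Prop where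
  map_one : T 1 = 1
  map_mul_comm : ∀ a ∈ M, ∀ b ∈ M, T (a * b) = T (b * a)
  nonneg_star_mul_self : ∀ a ∈ M, 0 ≤ T (star a * a)
  eq_zero : ∀ a ∈ M, T (star a * a) = 0 → a = 0
  map_star : ∀ a ∈ M, T (star a) = T a

variable {M : VonNeumannAlgebra H} {T : (H →L[ℂ] H) →ₗ[ℝ] ℝ}

theorem exists_eq_star_mul_self {h : H →L[ℂ] H} (hh : h ∈ M) (h0 : 0 ≤ h) :
    ∃ b ∈ M, h = star b * b := by
  have hs : IsSelfAdjoint (cfc Real.sqrt h) := cfc_predicate _ _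
  refine ⟨cfc Real.sqrt h, cfc_mem _ hh, ?_⟩
  rw [hs.star_eq, ← cfc_mul _ _ h Real.continuous_sqrt.continuousOn
    Real.continuous_sqrt.continuousOn]
  conv_lhs => rw [← cfc_id ℝ h h0.isSelfAdjoint]
  exact cfc_congr fun x hx => (Real.mul_self_sqrt (spectrum_nonneg_of_nonneg h0 hx)).symm

theorem IsTrace.nonneg (hT : IsTrace M T) : ∀ h ∈ M, 0 ≤ h → 0 ≤ T h := by
  intro h hh h0
  obtain ⟨b, hb, rfl⟩ := exists_eq_star_mul_self hh h0
  exact hT.nonneg_star_mul_self b hb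

theorem IsTrace.mono (hT : IsTrace M T) {a b : H →L[ℂ] H} (ha : a ∈ M) (hb : b ∈ M)
    (hab : a ≤ b) : T a ≤ T b := by
  have := hT.nonneg (b - a) (sub_mem hb ha) (sub_nonneg.2 hab)
  rw [map_sub] at this
  linarith

theorem IsTrace.eq_zero_of_projection (hT : IsTrace M T) {p : H →L[ℂ] H} (hpM : p ∈ M)
    (hp : IsStarProjection p) (h : T p = 0) : p = 0 :=
  hT.eq_zero p hpM (by rw [hp.isSelfAdjoint.star_eq, hp.isIdempotentElem.eq, h])

theorem IsTrace.projection_pos (hT : IsTrace M T) {p : H →L[ℂ] H} (hpM : p ∈ M)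
    (hp : IsStarProjection p) (h : p ≠ 0) : 0 < T p :=
  (hT.nonneg p hpM hp.nonneg).lt_of_ne fun h0 => h (hT.eq_zero_of_projection hpM hp h0.symm)

theorem IsTrace.mul_star_self_comm (hT : IsTrace M T) {y : H →L[ℂ] H} (hy : y ∈ M) :
    T (y * star y) = T (star y * y) := hT.map_mul_comm y hy _ (star_mem hy)

/-- `T (y t t⋆ y⋆) ≤ ‖t‖² T (y⋆ y)`. -/
theorem IsTrace.mul_right_le (hT : IsTrace M T) {y t : H →L[ℂ] H} (hy : y ∈ M) (ht : t ∈ M) :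
    T (star (y * t) * (y * t)) ≤ ‖t‖ ^ 2 * T (star y * y) := by
  rw [← hT.mul_star_self_comm (mul_mem hy ht), ← hT.mul_star_self_comm hy, ← smul_eq_mul (‖t‖ ^ 2),
    ← map_smul]
  refine hT.mono (mul_mem (mul_mem hy ht) (star_mem (mul_mem hy ht)))
    (real_smul_mem _ (mul_mem hy (star_mem hy))) ?_
  have h1 : t * star t ≤ (‖t‖ ^ 2) • (1 : H →L[ℂ] H) := by
    refine (IsSelfAdjoint.le_algebraMap_norm_self (IsSelfAdjoint.mul_star_self t)).trans ?_
    rw [CStarRing.norm_self_mul_star, Algebra.algebraMap_eq_smul_one, pow_two]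
  have h2 := star_right_conjugate_le_conjugate h1 y
  rw [mul_smul_comm, smul_mul_assoc, mul_one] at h2
  rwa [star_mul, mul_assoc y t, ← mul_assoc t, ← mul_assoc y]

theorem vectorFunctional_star_mul_self (ξ : H) (y : H →L[ℂ] H) :
    vectorFunctional ξ (star y * y) = ‖y ξ‖ ^ 2 := by
  rw [vectorFunctional_apply, mul_apply_eq_comp, ContinuousLinearMap.star_eq_adjoint,
    ContinuousLinearMap.adjoint_inner_left, inner_self_eq_norm_sq_to_K]
  norm_cast

theorem vectorFunctional_nonneg (ξ : H) : ∀ h ∈ M, 0 ≤ h → 0 ≤ vectorFunctional ξ h := by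
  intro h hh h0
  obtain ⟨b, -, rfl⟩ := exists_eq_star_mul_self hh h0
  rw [vectorFunctional_star_mul_self]
  positivity

theorem vectorFunctional_projection (ξ : H) {s : H →L[ℂ] H} (hs : IsStarProjection s) :
    vectorFunctional ξ s = ‖s ξ‖ ^ 2 := by
  rw [← vectorFunctional_star_mul_self, hs.isSelfAdjoint.star_eq, hs.isIdempotentElem.eq]

/-- On some nonzero corner the trace is dominated by a vector functional. -/
theorem IsTrace.exists_corner_le (hT : IsTrace M T) {η : H} (hη : 1 < ‖η‖ ^ 2) :
    ∃ q ∈ M, IsStarProjection q ∧ q ≠ 0 ∧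
      ∀ h ∈ M, 0 ≤ h → h * (1 - q) = 0 → T h ≤ vectorFunctional η h := by
  obtain ⟨q, hqM, hq, -, hq0, h⟩ := exists_projection_le (M := M) hT.nonneg
    (vectorFunctional_nonneg η) (one_mem M) (IsStarProjection.one _)
    (ξ := η) (fun s _ hs _ => (vectorFunctional_projection η hs).le)
    (by rw [hT.map_one, vectorFunctional_projection η (IsStarProjection.one _)]; exact hη)
  exact ⟨q, hqM, hq, hq0, h⟩

theorem IsTrace.nontrivial (hT : IsTrace M T) : Nontrivial H := by
  by_contra h
  rw [not_nontrivial_iff_subsingleton] at h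
  have h1 : (1 : H →L[ℂ] H) = 0 := Subsingleton.elim _ _
  have := hT.map_one
  rw [h1, map_zero] at this
  exact zero_ne_one this

/-- The trace is dominated by a finite sum of vector functionals. -/
theorem IsTrace.exists_dominating_list (hT : IsTrace M T) (hM : IsFactor M) :
    ∃ L : List H, ∀ y ∈ M, T (star y * y) ≤ (L.map fun ξ => ‖y ξ‖ ^ 2).sum := by
  have := hT.nontrivial
  obtain ⟨η, hη⟩ := exists_one_lt_norm_sq (H := H)
  obtain ⟨q, hqM, hq, hq0, hqT⟩ := hT.exists_corner_le hη
  have hqpos := hT.projection_pos hqM hq hq0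
  have hcorner : ∀ y ∈ M, T (y * q * star y) ≤ ‖y (q η)‖ ^ 2 := by
    intro y hy
    have h1 : T (y * q * star y) = T (star (y * q) * (y * q)) := by
      rw [← hT.mul_star_self_comm (mul_mem hy hqM), star_mul, hq.isSelfAdjoint.star_eq, mul_assoc,
        mul_assoc, ← mul_assoc q q, hq.isIdempotentElem.eq]
    rw [h1, ← mul_apply_eq_comp, ← vectorFunctional_star_mul_self]
    have hyq := mul_mem hy hqM
    refine hqT _ (mul_mem (star_mem hyq) hyq) (star_mul_self_nonneg _) ?_
    rw [mul_assoc, mul_assoc, hq.mul_one_sub_self, mul_zero, mul_zero]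
  have key : ∀ N : ℕ, ∀ p ∈ M, IsStarProjection p → T p ≤ N * T q →
      ∃ L : List H, ∀ y ∈ M, T (y * p * star y) ≤ (L.map fun ξ => ‖y ξ‖ ^ 2).sum := by
    intro N
    induction N with
    | zero =>
      intro p hpM hp hle
      have hp0 : p = 0 := hT.eq_zero_of_projection hpM hp
        (le_antisymm (by simpa using hle) (hT.nonneg p hpM hp.nonneg))
      refine ⟨[], fun y _ => ?_⟩
      simp [hp0]
    | succ N ih =>
      intro p hpM hp hle
      obtain ⟨v, hvM, hv, hqv, hvp, hor⟩ := hM.comparison hpM hqM hp hq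
      have hvv : IsStarProjection (star v * v) :=
        ⟨by rw [IsIdempotentElem, mul_assoc, ← mul_assoc v, hv], IsSelfAdjoint.star_mul_self v⟩
      have h1 : ∀ y ∈ M, T (y * (star v * v) * star y) ≤ ‖y (star v (q η))‖ ^ 2 := by
        intro y hy
        have h2 := hcorner (y * star v) (mul_mem hy (star_mem hvM))
        rw [star_mul, star_star, mul_apply_eq_comp] at h2
        convert h2 using 2
        nth_rewrite 2 [← hqv]
        simp only [mul_assoc]
      rcases hor with h | h
      · refine ⟨[star v (q η)], fun y hy => ?_⟩
        simpa [← h] using h1 y hy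
      · have hlep : star v * v * p = star v * v := by rw [mul_assoc, hvp]
        have hvvM : star v * v ∈ M := mul_mem (star_mem hvM) hvM
        obtain ⟨L, hL⟩ := ih (p - star v * v) (sub_mem hpM hvvM)
          (isStarProjection_sub hp hvv hlep) (by
            rw [map_sub, ← hT.mul_star_self_comm hvM, h]
            push_cast at hle
            linarith)
        refine ⟨star v (q η) :: L, fun y hy => ?_⟩
        have h3 := h1 y hy
        have h4 := hL y hy
        rw [mul_sub, sub_mul, map_sub] at h4
        rw [List.map_cons, List.sum_cons]
        linarith
  obtain ⟨N, hN⟩ := exists_nat_ge (T 1 / T q)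
  obtain ⟨L, hL⟩ := key N 1 (one_mem M) (IsStarProjection.one _) (by rwa [div_le_iff₀ hqpos] at hN)
  refine ⟨L, fun y hy => ?_⟩
  rw [← hT.mul_star_self_comm hy]
  simpa using hL y hy

/-- The vectors `ξ` for which `y ↦ y ξ` is bounded for the trace norm. -/
def boundedVectors (M : VonNeumannAlgebra H) (T : (H →L[ℂ] H) →ₗ[ℝ] ℝ) :
    Submodule ℂ H where
  carrier := {ξ | ∃ C : ℝ, ∀ y ∈ M, ‖y ξ‖ ^ 2 ≤ C * T (star y * y)}
  zero_mem' := ⟨0, fun y _ => by simp⟩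
  add_mem' := by
    rintro ξ η ⟨C, hC⟩ ⟨D, hD⟩
    refine ⟨2 * (C + D), fun y hy => ?_⟩
    have h1 := hC y hy
    have h2 := hD y hy
    have h3 := norm_add_le (y ξ) (y η)
    rw [map_add]
    nlinarith [norm_nonneg (y ξ), norm_nonneg (y η), norm_nonneg (y ξ + y η),
      sq_nonneg (‖y ξ‖ - ‖y η‖)]
  smul_mem' := by
    rintro c ξ ⟨C, hC⟩
    refine ⟨‖c‖ ^ 2 * C, fun y hy => ?_⟩
    rw [map_smul, norm_smul, mul_pow, mul_assoc]
    exact mul_le_mul_of_nonneg_left (hC y hy) (sq_nonneg _)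

theorem IsTrace.exists_boundedVector_ne_zero (hT : IsTrace M T) :
    ∃ ξ ∈ boundedVectors M T, ξ ≠ 0 := by
  have := hT.nontrivial
  obtain ⟨η, hη⟩ := exists_one_lt_norm_sq (H := H)
  obtain ⟨q, hqM, hq, hq0, hqT⟩ := hT.exists_corner_le hη
  have hqpos := hT.projection_pos hqM hq hq0
  set C : ℝ := ‖q η‖ ^ 2 / T q + 1 with hC
  have hC0 : 0 ≤ C := by positivity
  have hproj : ∀ s ∈ M, IsStarProjection s → s * q = s → T s ≤ ‖s η‖ ^ 2 := by
    intro s hsM hs hsq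
    rw [← vectorFunctional_projection η hs]
    exact hqT s hsM hs.nonneg (by rw [mul_sub, hsq, mul_one, sub_self])
  obtain ⟨q', hqM', hq', hqq', hq0', hle⟩ := exists_projection_le (M := M)
    (vectorFunctional_nonneg η) (g := C • T)
    (fun h hh h0 => mul_nonneg hC0 (hT.nonneg h hh h0)) hqM hq (ξ := (Real.sqrt C : ℂ) • η)
    (fun s hsM hs hsq => by
      rw [map_smul, norm_smul, mul_pow, Complex.norm_real, Real.norm_of_nonneg (Real.sqrt_nonneg _),
        Real.sq_sqrt hC0]
      exact mul_le_mul_of_nonneg_left (hproj s hsM hs hsq) hC0)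
    (by
      rw [vectorFunctional_projection η hq, LinearMap.smul_apply, smul_eq_mul, hC, add_mul,
        div_mul_cancel₀ _ hqpos.ne']
      linarith)
  refine ⟨q' η, ⟨C, fun y hy => ?_⟩, fun h => ?_⟩
  · have hyq := mul_mem hy hqM'
    have h1 := hle _ (mul_mem (star_mem hyq) hyq) (star_mul_self_nonneg _) (by
      rw [mul_assoc, mul_assoc, hq'.mul_one_sub_self, mul_zero, mul_zero])
    rw [vectorFunctional_star_mul_self, mul_apply_eq_comp, LinearMap.smul_apply, smul_eq_mul] at h1
    refine h1.trans (mul_le_mul_of_nonneg_left ?_ hC0)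
    refine (hT.mul_right_le hy hqM').trans ?_
    have h2 := hT.nonneg_star_mul_self y hy
    have h3 : ‖q'‖ ≤ 1 := IsStarProjection.norm_le q' hq'
    have h4 : ‖q'‖ ^ 2 ≤ 1 := pow_le_one₀ (norm_nonneg _) h3
    nlinarith
  · have h1 := hT.projection_pos hqM' hq' hq0'
    have h2 := hproj q' hqM' hq' hqq'
    rw [h, norm_zero] at h2
    linarith [h2]

theorem IsTrace.closure_boundedVectors (hT : IsTrace M T) (hM : IsFactor M) :
    (boundedVectors M T).topologicalClosure = ⊤ := by
  have h1 : ∀ t ∈ M, ∀ ξ ∈ boundedVectors M T, t ξ ∈ boundedVectors M T := by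
    rintro t ht ξ ⟨C, hC⟩
    refine ⟨|C| * ‖t‖ ^ 2, fun y hy => ?_⟩
    have h2 := hC (y * t) (mul_mem hy ht)
    rw [mul_apply_eq_comp] at h2
    rw [mul_assoc]
    refine (h2.trans (mul_le_mul_of_nonneg_right (le_abs_self C)
      (hT.nonneg_star_mul_self _ (mul_mem hy ht)))).trans ?_
    exact mul_le_mul_of_nonneg_left (hT.mul_right_le hy ht) (abs_nonneg C)
  have h2 : ∀ t ∈ M.commutant, ∀ ξ ∈ boundedVectors M T, t ξ ∈ boundedVectors M T := by
    rintro t ht ξ ⟨C, hC⟩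
    refine ⟨‖t‖ ^ 2 * C, fun y hy => ?_⟩
    have h3 := DFunLike.congr_fun (commute_of_mem ht hy).eq ξ
    simp only [mul_apply_eq_comp] at h3
    rw [← h3, mul_assoc]
    calc ‖t (y ξ)‖ ^ 2 ≤ (‖t‖ * ‖y ξ‖) ^ 2 := by gcongr; exact t.le_opNorm _
      _ = ‖t‖ ^ 2 * ‖y ξ‖ ^ 2 := mul_pow _ _ _
      _ ≤ _ := mul_le_mul_of_nonneg_left (hC y hy) (sq_nonneg _)
  refine (hM.eq_bot_or_top _ (Submodule.isClosed_topologicalClosure _) ?_ ?_).resolve_left ?_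
  · exact fun t ht ξ hξ => map_mem_closure t.continuous hξ fun ζ hζ => h1 t ht ζ hζ
  · exact fun t ht ξ hξ => map_mem_closure t.continuous hξ fun ζ hζ => h2 t ht ζ hζ
  · intro h
    obtain ⟨ξ, hξ, hξ0⟩ := hT.exists_boundedVector_ne_zero
    have := (boundedVectors M T).le_topologicalClosure hξ
    rw [h] at this
    exact hξ0 this

theorem IsTrace.tendsto_trace (hT : IsTrace M T) (hM : IsFactor M) {ι : Type*} {l : Filter ι}
    {y : ι → H →L[ℂ] H} (hy : ∀ k, y k ∈ M)
    (h : ∀ ξ, Tendsto (fun k => y k ξ) l (nhds 0)) :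
    Tendsto (fun k => T (star (y k) * y k)) l (nhds 0) := by
  obtain ⟨L, hL⟩ := hT.exists_dominating_list hM
  have hlim : ∀ L : List H, Tendsto (fun k => (L.map fun ξ => ‖y k ξ‖ ^ 2).sum) l (nhds 0) := by
    intro L
    induction L with
    | nil => simpa using tendsto_const_nhds
    | cons ξ L ih =>
      have h1 := ((h ξ).norm.pow 2).add ih
      simpa using h1
  exact tendsto_of_tendsto_of_tendsto_of_le_of_le tendsto_const_nhds (hlim L)
    (fun k => hT.nonneg_star_mul_self _ (hy k)) (fun k => hL _ (hy k))

theorem IsTrace.tendsto_apply (hT : IsTrace M T) (hM : IsFactor M) {ι : Type*} {l : Filter ι}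
    {y : ι → H →L[ℂ] H} (hy : ∀ k, y k ∈ M) {C : ℝ} (hC : ∀ k, ‖y k‖ ≤ C)
    (h : Tendsto (fun k => T (star (y k) * y k)) l (nhds 0)) (ξ : H) :
    Tendsto (fun k => y k ξ) l (nhds 0) := by
  have hb : ∀ ζ ∈ boundedVectors M T, Tendsto (fun k => y k ζ) l (nhds 0) := by
    rintro ζ ⟨D, hD⟩
    have h1 : Tendsto (fun k => ‖y k ζ‖ ^ 2) l (nhds 0) := by
      have h2 := h.const_mul D
      rw [mul_zero] at h2
      exact tendsto_of_tendsto_of_tendsto_of_le_of_le tendsto_const_nhds h2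
        (fun k => sq_nonneg _) (fun k => hD _ (hy k))
    rw [tendsto_zero_iff_norm_tendsto_zero]
    have h3 := h1.sqrt
    simpa [Real.sqrt_sq] using h3
  have hξ : ξ ∈ closure (boundedVectors M T : Set H) := by
    rw [← Submodule.topologicalClosure_coe, hT.closure_boundedVectors hM]
    trivial
  rw [Metric.tendsto_nhds]
  intro ε hε
  have hC0 : 0 < |C| + 1 := by positivity
  obtain ⟨ζ, hζ, hd⟩ := Metric.mem_closure_iff.1 hξ (ε / 2 / (|C| + 1)) (by positivity)
  filter_upwards [Metric.tendsto_nhds.1 (hb ζ hζ) (ε / 2) (half_pos hε)] with k hk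
  rw [dist_zero_right] at hk ⊢
  have h1 : y k ξ = y k (ξ - ζ) + y k ζ := by rw [map_sub, sub_add_cancel]
  have h2 : ‖y k (ξ - ζ)‖ ≤ (|C| + 1) * ‖ξ - ζ‖ :=
    ContinuousLinearMap.le_of_opNorm_le _ ((hC k).trans (by linarith [le_abs_self C])) _
  rw [dist_eq_norm, lt_div_iff₀ hC0] at hd
  rw [h1]
  calc _ ≤ ‖y k (ξ - ζ)‖ + ‖y k ζ‖ := norm_add_le _ _
    _ < ε := by nlinarith

end Trace

section Sequences

variable {H : Type*} [NormedAddCommGroup H] [InnerProductSpace ℂ H] [CompleteSpace H]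
  {M : VonNeumannAlgebra H} {T : (H →L[ℂ] H) →ₗ[ℝ] ℝ} {ι : Type*} {l : Filter ι}

theorem IsTrace.mul_left_le (hT : IsTrace M T) {y t : H →L[ℂ] H} (hy : y ∈ M) (ht : t ∈ M) :
    T (star (t * y) * (t * y)) ≤ ‖t‖ ^ 2 * T (star y * y) := by
  have h := hT.mul_right_le (star_mem hy) (star_mem ht)
  rw [← star_mul, star_star, norm_star, star_star] at h
  rwa [← hT.mul_star_self_comm (mul_mem ht hy), ← hT.mul_star_self_comm hy]

theorem IsTrace.add_le (hT : IsTrace M T) {a b : H →L[ℂ] H} (ha : a ∈ M) (hb : b ∈ M) :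
    T (star (a + b) * (a + b)) ≤ 2 * T (star a * a) + 2 * T (star b * b) := by
  have h := hT.nonneg_star_mul_self (a - b) (sub_mem ha hb)
  simp only [star_add, star_sub, add_mul, mul_add, sub_mul, mul_sub, map_add, map_sub] at h ⊢
  linarith

theorem IsTrace.sq_le (hT : IsTrace M T) {a : H →L[ℂ] H} (ha : a ∈ M) :
    T a ^ 2 ≤ T (star a * a) := by
  have h := hT.nonneg_star_mul_self (a - T a • 1) (sub_mem ha (real_smul_mem _ (one_mem M)))
  have h1 : star (a - T a • (1 : H →L[ℂ] H)) * (a - T a • 1) =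
      star a * a - T a • star a - T a • a + (T a * T a) • 1 := by
    rw [star_sub, star_smul, star_one, star_trivial (T a), sub_mul, mul_sub, mul_sub, mul_smul_comm,
      mul_one, smul_mul_smul_comm, mul_one, smul_mul_assoc, one_mul]
    abel
  rw [h1, map_add, map_sub, map_sub, map_smul, map_smul, map_smul, hT.map_star a ha,
    hT.map_one] at h
  simp only [smul_eq_mul] at h
  nlinarith

/-- The algebra of bounded sequences in `M`. -/
def boundedSeq (M : VonNeumannAlgebra H) (ι : Type*) : StarSubalgebra ℂ (ι → H →L[ℂ] H) where
  carrier := {y | (∀ k, y k ∈ M) ∧ ∃ C : ℝ, ∀ k, ‖y k‖ ≤ C}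
  mul_mem' := by
    rintro a b ⟨ha, C, hC⟩ ⟨hb, D, hD⟩
    refine ⟨fun k => mul_mem (ha k) (hb k), C * D, fun k => (norm_mul_le _ _).trans ?_⟩
    exact mul_le_mul (hC k) (hD k) (norm_nonneg _) ((norm_nonneg _).trans (hC k))
  add_mem' := by
    rintro a b ⟨ha, C, hC⟩ ⟨hb, D, hD⟩
    exact ⟨fun k => add_mem (ha k) (hb k), C + D,
      fun k => (norm_add_le _ _).trans (add_le_add (hC k) (hD k))⟩
  algebraMap_mem' := by
    intro c
    refine ⟨fun k => M.toStarSubalgebra.algebraMap_mem c, ‖algebraMap ℂ (H →L[ℂ] H) c‖,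
      fun k => le_rfl⟩
  star_mem' := by
    rintro a ⟨ha, C, hC⟩
    exact ⟨fun k => star_mem (ha k), C, fun k => by simpa using hC k⟩

/-- The constant sequence. -/
def constSeq (ι : Type*) (m : H →L[ℂ] H) (hm : m ∈ M) : boundedSeq M ι :=
  ⟨fun _ => m, fun _ => hm, ‖m‖, fun _ => le_rfl⟩

/-- The ideal of bounded sequences tending to zero in trace norm along `l`. -/
def nullIdeal (hT : IsTrace M T) (l : Filter ι) : Ideal (boundedSeq M ι) where
  carrier := {y | Tendsto (fun k => T (star (y.1 k) * y.1 k)) l (nhds 0)}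
  zero_mem' := by
    simpa using tendsto_const_nhds
  add_mem' := by
    intro a b ha hb
    have h := (ha.const_mul 2).add (hb.const_mul 2)
    rw [mul_zero, add_zero] at h
    exact tendsto_of_tendsto_of_tendsto_of_le_of_le tendsto_const_nhds h
      (fun k => hT.nonneg_star_mul_self _ ((a + b).2.1 k))
      (fun k => hT.add_le (a.2.1 k) (b.2.1 k))
  smul_mem' := by
    intro c a ha
    obtain ⟨C, hC⟩ := c.2.2
    have h := ha.const_mul (C ^ 2)
    rw [mul_zero] at h
    refine tendsto_of_tendsto_of_tendsto_of_le_of_le tendsto_const_nhds h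
      (fun k => hT.nonneg_star_mul_self _ ((c * a).2.1 k))
      (fun k => (hT.mul_left_le (a.2.1 k) (c.2.1 k)).trans ?_)
    have := hT.nonneg_star_mul_self _ (a.2.1 k)
    have h2 := pow_le_pow_left₀ (norm_nonneg _) (hC k) 2
    exact mul_le_mul_of_nonneg_right h2 this

theorem mem_nullIdeal (hT : IsTrace M T) {y : boundedSeq M ι} :
    y ∈ nullIdeal hT l ↔ Tendsto (fun k => T (star (y.1 k) * y.1 k)) l (nhds 0) := Iff.rfl

instance (hT : IsTrace M T) (l : Filter ι) : (nullIdeal hT l).IsTwoSided where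
  mul_mem_of_left := by
    intro a c ha
    obtain ⟨C, hC⟩ := c.2.2
    have h := ((mem_nullIdeal hT).1 ha).const_mul (C ^ 2)
    rw [mul_zero] at h
    refine tendsto_of_tendsto_of_tendsto_of_le_of_le tendsto_const_nhds h
      (fun k => hT.nonneg_star_mul_self _ ((a * c).2.1 k))
      (fun k => (hT.mul_right_le (a.2.1 k) (c.2.1 k)).trans ?_)
    have := hT.nonneg_star_mul_self _ (a.2.1 k)
    have h2 := pow_le_pow_left₀ (norm_nonneg _) (hC k) 2
    exact mul_le_mul_of_nonneg_right h2 this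

theorem star_mem_nullIdeal (hT : IsTrace M T) {y : boundedSeq M ι} (hy : y ∈ nullIdeal hT l) :
    star y ∈ nullIdeal hT l := by
  rw [mem_nullIdeal] at hy ⊢
  refine hy.congr fun k => ?_
  rw [← hT.mul_star_self_comm (y.2.1 k)]
  exact congrArg (fun z => T (z * star (y.1 k))) (star_star (y.1 k)).symm

/-- The tracial ultrapower (along an arbitrary filter). -/
def UltraPower (hT : IsTrace M T) (l : Filter ι) := boundedSeq M ι ⧸ nullIdeal hT l

noncomputable instance (hT : IsTrace M T) (l : Filter ι) : Ring (UltraPower hT l) :=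
  inferInstanceAs (Ring (boundedSeq M ι ⧸ nullIdeal hT l))

/-- The quotient map onto the ultrapower. -/
noncomputable def toUltra (hT : IsTrace M T) (l : Filter ι) : boundedSeq M ι →+* UltraPower hT l :=
  Ideal.Quotient.mk (nullIdeal hT l)

theorem toUltra_eq_iff_sub_mem (hT : IsTrace M T) {a b : boundedSeq M ι} :
    toUltra hT l a = toUltra hT l b ↔ a - b ∈ nullIdeal hT l :=
  Ideal.Quotient.mk_eq_mk_iff_sub_mem a b

theorem toUltra_eq_iff (hT : IsTrace M T) {a b : boundedSeq M ι} :
    toUltra hT l a = toUltra hT l b ↔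
      Tendsto (fun k => T (star (a.1 k - b.1 k) * (a.1 k - b.1 k))) l (nhds 0) := by
  rw [toUltra_eq_iff_sub_mem]
  rfl

theorem toUltra_star_eq (hT : IsTrace M T) {a b : boundedSeq M ι}
    (h : toUltra hT l a = toUltra hT l b) : toUltra hT l (star a) = toUltra hT l (star b) := by
  rw [toUltra_eq_iff_sub_mem] at h ⊢
  have h1 : star a - star b = star (a - b) := Subtype.ext (star_sub a.1 b.1).symm
  rw [h1]
  exact star_mem_nullIdeal hT h

theorem tendsto_trace_sub (hT : IsTrace M T) {a b : boundedSeq M ι}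
    (h : toUltra hT l a = toUltra hT l b) :
    Tendsto (fun k => T (a.1 k) - T (b.1 k)) l (nhds 0) := by
  rw [toUltra_eq_iff] at h
  have h1 : Tendsto (fun k => (T (a.1 k) - T (b.1 k)) ^ 2) l (nhds 0) :=
    tendsto_of_tendsto_of_tendsto_of_le_of_le tendsto_const_nhds h (fun k => sq_nonneg _)
      (fun k => by rw [← map_sub]; exact hT.sq_le (sub_mem (a.2.1 k) (b.2.1 k)))
  rw [tendsto_zero_iff_abs_tendsto_zero]
  have h2 := h1.sqrt
  simpa [Real.sqrt_sq_eq_abs, Function.comp_def] using h2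

theorem toUltra_eq_of_le (hT : IsTrace M T) {a b c d : boundedSeq M ι}
    (h : toUltra hT l c = toUltra hT l d) (C : ℝ)
    (hle : ∀ k, T (star (a.1 k - b.1 k) * (a.1 k - b.1 k)) ≤
      C * T (star (c.1 k - d.1 k) * (c.1 k - d.1 k))) :
    toUltra hT l a = toUltra hT l b := by
  rw [toUltra_eq_iff] at h ⊢
  have h1 := h.const_mul C
  rw [mul_zero] at h1
  exact tendsto_of_tendsto_of_tendsto_of_le_of_le tendsto_const_nhds h1
    (fun k => hT.nonneg_star_mul_self _ (sub_mem (a.2.1 k) (b.2.1 k))) hle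

end Sequences

section Perturbation

variable {H : Type*} [NormedAddCommGroup H] [InnerProductSpace ℂ H] [CompleteSpace H]
  {M : VonNeumannAlgebra H} {T : (H →L[ℂ] H) →ₗ[ℝ] ℝ}

theorem isStarProjection_star_mul_self {v : H →L[ℂ] H} (hv : v * star v * v = v) :
    IsStarProjection (star v * v) :=
  ⟨by rw [IsIdempotentElem, mul_assoc, ← mul_assoc v, hv], IsSelfAdjoint.star_mul_self v⟩

theorem isStarProjection_mul_star_self {v : H →L[ℂ] H} (hv : v * star v * v = v) :
    IsStarProjection (v * star v) :=
  ⟨by rw [IsIdempotentElem, ← mul_assoc, hv], IsSelfAdjoint.mul_star_self v⟩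

/-- In a finite factor, a projection of smaller trace is equivalent to a subprojection. -/
theorem IsTrace.exists_subequiv (hT : IsTrace M T) (hM : IsFactor M) {p q : H →L[ℂ] H}
    (hpM : p ∈ M) (hqM : q ∈ M) (hp : IsStarProjection p) (hq : IsStarProjection q)
    (h : T p ≤ T q) : ∃ v ∈ M, star v * v = p ∧ q * v = v := by
  obtain ⟨v, hvM, hv, hqv, hvp, hor⟩ := hM.comparison hpM hqM hp hq
  refine ⟨v, hvM, ?_, hqv⟩
  rcases hor with h1 | h1
  · exact h1
  · have hsM : star v * v ∈ M := mul_mem (star_mem hvM) hvM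
    have h2 : IsStarProjection (p - star v * v) := isStarProjection_sub hp
      (isStarProjection_star_mul_self hv) (by rw [mul_assoc, hvp])
    have h3 := hT.nonneg _ (sub_mem hpM hsM) h2.nonneg
    have h4 : T (p - star v * v) = 0 := by
      rw [map_sub, ← hT.mul_star_self_comm hvM, h1] at h3 ⊢
      linarith
    exact (sub_eq_zero.1 (hT.eq_zero_of_projection (sub_mem hpM hsM) h2 h4)).symm

theorem IsTrace.exists_equiv (hT : IsTrace M T) (hM : IsFactor M) {p q : H →L[ℂ] H}
    (hpM : p ∈ M) (hqM : q ∈ M) (hp : IsStarProjection p) (hq : IsStarProjection q)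
    (h : T p = T q) : ∃ v ∈ M, star v * v = p ∧ v * star v = q := by
  obtain ⟨v, hvM, hv, hqv⟩ := hT.exists_subequiv hM hpM hqM hp hq h.le
  refine ⟨v, hvM, hv, ?_⟩
  have hvv : v * star v * v = v := by rw [mul_assoc, hv, mul_eq_self_of_star_mul_self hp hv]
  have hsM : v * star v ∈ M := mul_mem hvM (star_mem hvM)
  have h1 := isStarProjection_mul_star_self hvv
  have h2 : IsStarProjection (q - v * star v) := isStarProjection_sub hq h1 (by
    have : q * (v * star v) = v * star v := by rw [← mul_assoc, hqv]
    simpa only [star_mul, star_star, hq.isSelfAdjoint.star_eq] using congrArg star this)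
  have h4 : T (q - v * star v) = 0 := by
    rw [map_sub, hT.mul_star_self_comm hvM, hv, h, sub_self]
  exact (sub_eq_zero.1 (hT.eq_zero_of_projection (sub_mem hqM hsM) h2 h4)).symm

theorem IsTrace.exists_projection_near (hT : IsTrace M T) {a : H →L[ℂ] H} (haM : a ∈ M)
    (ha : IsSelfAdjoint a) : ∃ s ∈ M, IsStarProjection s ∧
      T (star (a - s) * (a - s)) ≤ 4 * T (star (a * a - a) * (a * a - a)) := by
  have hbM : a + a - 1 ∈ M := sub_mem (add_mem haM haM) (one_mem M)
  have hb : IsSelfAdjoint (a + a - 1) := (ha.add ha).sub (IsSelfAdjoint.one _)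
  obtain ⟨s, hsM, hs, hsc, hs1, hs2⟩ := exists_spectral_projection hbM hb
  refine ⟨s, hsM, hs, ?_⟩
  set b := a + a - 1 with hbdef
  set u : H →L[ℂ] H := s + s - 1 with hu
  have hss := hs.isIdempotentElem.eq
  have huu : u * u = 1 := by
    simp only [hu, mul_sub, sub_mul, mul_add, add_mul, hss, mul_one, one_mul]
    abel
  have hub : u * b = b * u := by
    simp only [hu, mul_sub, sub_mul, mul_add, add_mul, mul_one, one_mul, hsc.eq]
  set d := u * b with hd
  have hd0 : 0 ≤ d := by
    have : d = s * b + -((1 - s) * b) := by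
      simp only [hd, hu, sub_mul, add_mul, one_mul]
      abel
    rw [this]
    exact add_nonneg hs1 (neg_nonneg.2 hs2)
  have hds := hd0.isSelfAdjoint
  have huM : u ∈ M := sub_mem (add_mem hsM hsM) (one_mem M)
  have hdM : d ∈ M := mul_mem huM hbM
  have hdd : d * d = b * b := by
    rw [hd, mul_assoc, ← mul_assoc b, ← hub, mul_assoc u, ← mul_assoc u, huu, one_mul]
  have hud : u * d = b := by rw [hd, ← mul_assoc, huu, one_mul]
  have hdu : d * u = b := by rw [hd, mul_assoc, ← hub, ← mul_assoc, huu, one_mul]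
  have h1 : (4 : ℝ) • (star (a - s) * (a - s)) = (d - 1) * (d - 1) := by
    rw [(ha.sub hs.isSelfAdjoint).star_eq]
    have h2 : (a - s) + (a - s) = (d - 1) * u := by
      rw [sub_mul, hdu, one_mul, hbdef, hu]
      abel
    have h2' : (a - s) + (a - s) = u * (d - 1) := by
      rw [mul_sub, hud, mul_one, hbdef, hu]
      abel
    have h3 : (4 : ℝ) • ((a - s) * (a - s)) = ((a - s) + (a - s)) * ((a - s) + (a - s)) := by
      simp only [mul_add, add_mul]
      module
    rw [h3]
    nth_rewrite 1 [h2]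
    rw [h2', mul_assoc, ← mul_assoc u, huu, one_mul]
  have h2 : (16 : ℝ) • (star (a * a - a) * (a * a - a)) =
      (d - 1) * (d - 1) + (d - 1) * (d * d + (d + d)) * (d - 1) := by
    have hsa : IsSelfAdjoint (a * a - a) := by
      rw [IsSelfAdjoint, star_sub, star_mul, ha.star_eq]
    rw [hsa.star_eq]
    have h3 : (4 : ℝ) • (a * a - a) = d * d - 1 := by
      rw [hdd, hbdef]
      simp only [mul_sub, sub_mul, mul_add, add_mul, mul_one, one_mul]
      module
    have h4 : (16 : ℝ) • ((a * a - a) * (a * a - a)) =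
        ((4 : ℝ) • (a * a - a)) * ((4 : ℝ) • (a * a - a)) := by
      rw [smul_mul_smul_comm]
      norm_num
    rw [h4, h3]
    noncomm_ring
  have hd1 : IsSelfAdjoint (d - 1) := hds.sub (IsSelfAdjoint.one _)
  have hpos : 0 ≤ (d - 1) * (d * d + (d + d)) * (d - 1) := by
    refine hd1.conjugate_nonneg (add_nonneg ?_ (add_nonneg hd0 hd0))
    have := star_mul_self_nonneg d
    rwa [hds.star_eq] at this
  have hd1M : d - 1 ∈ M := sub_mem hdM (one_mem M)
  have h5 := hT.nonneg _ (mul_mem (mul_mem hd1M (add_mem (mul_mem hdM hdM)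
    (add_mem hdM hdM))) hd1M) hpos
  have h6 := congrArg T h1
  have h7 := congrArg T h2
  rw [map_smul, smul_eq_mul] at h6 h7
  rw [map_add] at h7
  linarith

theorem IsTrace.exists_unitary_near (hT : IsTrace M T) (hM : IsFactor M) {y : H →L[ℂ] H}
    (hy : y ∈ M) : ∃ u ∈ M, star u * u = 1 ∧ u * star u = 1 ∧
      T (star (y - u) * (y - u)) ≤
        36 * T (star (star y * y - 1) * (star y * y - 1)) := by
  obtain ⟨s, hsM, r, hrM, w, hwM, hs, hs2, hws, hr0, hrr, hwr, -, -⟩ :=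
    exists_polar_cut hy (t := 1 / 2) (by norm_num)
  set h := star y * y with hh
  have hhM : h ∈ M := mul_mem (star_mem hy) hy
  have hhs : IsSelfAdjoint h := IsSelfAdjoint.star_mul_self y
  have hss := hs.isIdempotentElem.eq
  have hw := mul_eq_self_of_star_mul_self hs hws
  have hww : w * star w * w = w := by rw [mul_assoc, hws, hw]
  have hwwP := isStarProjection_mul_star_self hww
  have hwwM : w * star w ∈ M := mul_mem hwM (star_mem hwM)
  have h1s := hs.one_sub
  have h1sM : 1 - s ∈ M := sub_mem (one_mem M) hsM
  obtain ⟨v, hvM, hv1, hv2⟩ := hT.exists_equiv hM h1sM (sub_mem (one_mem M) hwwM)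
    h1s hwwP.one_sub (by rw [map_sub, map_sub, hT.mul_star_self_comm hwM, hws])
  have hvs := mul_eq_self_of_star_mul_self h1s hv1
  have hwv : w * star v = 0 := by
    have : star v = (1 - s) * star v := by
      have := congrArg star hvs
      rw [star_mul, h1s.isSelfAdjoint.star_eq] at this
      exact this.symm
    rw [this, ← hw, mul_assoc, ← mul_assoc s, hs.mul_one_sub_self, zero_mul, mul_zero]
  have hwv' : star w * v = 0 := by
    have h1 : v = (1 - w * star w) * v := by
      rw [← hv2, mul_assoc, hv1, hvs]
    have h2 : star w * (1 - w * star w) = 0 := by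
      rw [mul_sub, mul_one, ← mul_assoc, hws, sub_eq_zero]
      have := congrArg star hw
      rw [star_mul, hs.isSelfAdjoint.star_eq] at this
      exact this.symm
    rw [h1, ← mul_assoc, h2, zero_mul]
  have hvw : v * star w = 0 := by
    simpa only [star_mul, star_star, star_zero] using congrArg star hwv
  have hvw' : star v * w = 0 := by
    simpa only [star_mul, star_star, star_zero] using congrArg star hwv'
  refine ⟨w + v, add_mem hwM hvM, ?_, ?_, ?_⟩
  · rw [star_add, add_mul, mul_add, mul_add, hws, hwv', hvw', hv1]
    abel
  · rw [star_add, add_mul, mul_add, mul_add, hwv, hvw, hv2]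
    abel
  set δ := T (star (h - 1) * (h - 1)) with hδ
  have hδ0 : 0 ≤ δ := hT.nonneg_star_mul_self _ (sub_mem hhM (one_mem M))
  have hsle : ‖s‖ ^ 2 ≤ 1 := pow_le_one₀ (norm_nonneg _) (IsStarProjection.norm_le s hs)
  have h1sle : ‖1 - s‖ ^ 2 ≤ 1 := pow_le_one₀ (norm_nonneg _) (IsStarProjection.norm_le _ h1s)
  have hTs : T (star (1 - s) * (1 - s)) = T (1 - s) := by
    rw [h1s.isSelfAdjoint.star_eq, h1s.isIdempotentElem.eq]
  -- the trace of the complement of `s`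
  have hcomp : T (1 - s) ≤ 4 * δ := by
    set g := -((1 - s) * (h - (1 / 2 : ℝ) • 1)) with hg
    have hg0 : 0 ≤ g := neg_nonneg.2 hs2
    have hg1 : (1 - s) * g = g := by
      rw [hg, mul_neg, ← mul_assoc, h1s.isIdempotentElem.eq]
    have hg2 : g * (1 - s) = g := by
      simpa only [star_mul, hg0.isSelfAdjoint.star_eq, h1s.isSelfAdjoint.star_eq]
        using congrArg star hg1
    have hgM : g ∈ M := neg_mem (mul_mem h1sM (sub_mem hhM (real_smul_mem _ (one_mem M))))
    have h3 : (1 - s) * (1 - h) = g + (1 / 2 : ℝ) • (1 - s) := by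
      rw [hg, mul_sub (1 - s) h, mul_sub (1 - s) 1, mul_smul_comm, mul_one]
      module
    have h3' : (1 - h) * (1 - s) = g + (1 / 2 : ℝ) • (1 - s) := by
      have := congrArg star h3
      rw [star_mul, star_add, star_smul, hg0.isSelfAdjoint.star_eq, h1s.isSelfAdjoint.star_eq,
        star_sub, star_one, hhs.star_eq, star_trivial (1 / 2 : ℝ)] at this
      exact this
    have h4 : star ((h - 1) * (1 - s)) * ((h - 1) * (1 - s)) =
        g * g + g + (1 / 4 : ℝ) • (1 - s) := by
      have h5 : (h - 1) * (1 - s) = -(g + (1 / 2 : ℝ) • (1 - s)) := by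
        rw [← h3', ← neg_mul, neg_sub]
      rw [h5, star_neg, neg_mul_neg, star_add, star_smul, hg0.isSelfAdjoint.star_eq,
        h1s.isSelfAdjoint.star_eq, star_trivial (1 / 2 : ℝ), add_mul, mul_add, mul_add,
        mul_smul_comm, smul_mul_assoc, smul_mul_smul_comm, hg1, hg2, h1s.isIdempotentElem.eq]
      module
    have h6 := hT.mul_right_le (sub_mem hhM (one_mem M)) h1sM
    rw [h4, map_add, map_add, map_smul, smul_eq_mul] at h6
    have h7 := hT.nonneg g hgM hg0
    have h8 := hT.nonneg_star_mul_self g hgM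
    rw [hg0.isSelfAdjoint.star_eq] at h8
    nlinarith
  have hy1 : T (star (y * (1 - s)) * (y * (1 - s))) ≤ 2 * δ := by
    have h3 : T (star (y * (1 - s)) * (y * (1 - s))) = T ((1 - s) * h) := by
      rw [star_mul, h1s.isSelfAdjoint.star_eq, mul_assoc, ← mul_assoc (star y), ← hh,
        ← mul_assoc, hT.map_mul_comm _ (mul_mem h1sM hhM) _ h1sM, ← mul_assoc,
        h1s.isIdempotentElem.eq]
    have h4 := hT.nonneg _ (neg_mem (mul_mem h1sM (sub_mem hhM (real_smul_mem (1 / 2)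
      (one_mem M))))) (neg_nonneg.2 hs2)
    rw [mul_sub, mul_smul_comm, mul_one, map_neg, map_sub, map_smul, smul_eq_mul] at h4
    rw [h3]
    linarith
  have hr1 : T (star (r - 1) * (r - 1)) ≤ T (star (r * r - 1) * (r * r - 1)) := by
    have h3 : star (r * r - 1) * (r * r - 1) =
        star (r - 1) * (r - 1) + star (r - 1) * (r * r + (r + r)) * (r - 1) := by
      rw [star_sub, star_sub, star_mul, star_one, hr0.isSelfAdjoint.star_eq]
      noncomm_ring
    have h4 : 0 ≤ r * r + (r + r) := by
      refine add_nonneg ?_ (add_nonneg hr0 hr0)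
      have := star_mul_self_nonneg r
      rwa [hr0.isSelfAdjoint.star_eq] at this
    have hr1M : r - 1 ∈ M := sub_mem hrM (one_mem M)
    have h5 := hT.nonneg _ (mul_mem (mul_mem (star_mem hr1M)
      (add_mem (mul_mem hrM hrM) (add_mem hrM hrM))) hr1M) (star_left_conjugate_nonneg h4 (r - 1))
    rw [h3, map_add]
    linarith
  have hr2 : T (star (r * r - 1) * (r * r - 1)) ≤ 4 * δ := by
    have h3 : r * r - 1 = (h - 1) * s + -((1 / 2 : ℝ) • (1 - s)) := by
      rw [hrr, sub_mul, one_mul]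
      module
    have h4 := hT.add_le (mul_mem (sub_mem hhM (one_mem M)) hsM)
      (neg_mem (real_smul_mem (1 / 2) h1sM))
    have h5 : star (-((1 / 2 : ℝ) • (1 - s))) * (-((1 / 2 : ℝ) • (1 - s))) =
        (1 / 4 : ℝ) • (1 - s) := by
      rw [star_neg, neg_mul_neg, star_smul, h1s.isSelfAdjoint.star_eq, star_trivial (1 / 2 : ℝ),
        smul_mul_smul_comm, h1s.isIdempotentElem.eq]
      norm_num
    have h6 := hT.mul_right_le (sub_mem hhM (one_mem M)) hsM
    rw [h3]
    rw [h5, map_smul, smul_eq_mul] at h4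
    nlinarith
  have hw1 : T (star (w * (r - 1)) * (w * (r - 1))) ≤ 4 * δ := by
    have h3 := hT.mul_left_le (sub_mem hrM (one_mem M)) hwM
    have h4 : ‖w‖ ^ 2 ≤ 1 := pow_le_one₀ (norm_nonneg _) (norm_le_one_of_idempotent (by
      rw [hws]; exact hs.isIdempotentElem))
    have h5 := hT.nonneg_star_mul_self (r - 1) (sub_mem hrM (one_mem M))
    nlinarith
  have hv3 : T (star (-v) * (-v)) ≤ 4 * δ := by
    rw [star_neg, neg_mul_neg, hv1]
    exact hcomp
  have hdec : y - (w + v) = y * (1 - s) + (w * (r - 1) + -v) := by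
    rw [mul_sub, mul_sub, hwr, mul_one, mul_one]
    abel
  have hwrM : w * (r - 1) ∈ M := mul_mem hwM (sub_mem hrM (one_mem M))
  have h3 := hT.add_le (mul_mem hy h1sM) (add_mem hwrM (neg_mem hvM))
  have h4 := hT.add_le hwrM (neg_mem hvM)
  rw [hdec]
  linarith

end Perturbation

section MatrixColumn

variable {H : Type*} [NormedAddCommGroup H] [InnerProductSpace ℂ H] [CompleteSpace H]
  {M : VonNeumannAlgebra H} {T : (H →L[ℂ] H) →ₗ[ℝ] ℝ}

/-- `M` has no minimal projections. -/
def IsDiffuse (M : VonNeumannAlgebra H) : Prop :=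
  ∀ p ∈ M, IsSelfAdjoint p → IsIdempotentElem p → p ≠ 0 →
    ∃ q ∈ M, IsSelfAdjoint q ∧ IsIdempotentElem q ∧ q * p = q ∧ q ≠ 0 ∧ q ≠ p

theorem IsDiffuse.exists_small_projection (hd : IsDiffuse M) (T : (H →L[ℂ] H) →ₗ[ℝ] ℝ)
    {p : H →L[ℂ] H}
    (hpM : p ∈ M) (hp : IsStarProjection p) (hp0 : p ≠ 0) {ε : ℝ} (hε : 0 < ε) :
    ∃ s ∈ M, IsStarProjection s ∧ s * p = s ∧ s ≠ 0 ∧ T s ≤ ε := by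
  have key : ∀ N : ℕ, ∃ s ∈ M, IsStarProjection s ∧ s * p = s ∧ s ≠ 0 ∧
      T s ≤ (1 / 2) ^ N * T p := by
    intro N
    induction N with
    | zero => exact ⟨p, hpM, hp, hp.isIdempotentElem.eq, hp0, by simp⟩
    | succ N ih =>
      obtain ⟨s, hsM, hs, hsp, hs0, hle⟩ := ih
      obtain ⟨q, hqM, hq1, hq2, hqs, hq0, hqne⟩ := hd s hsM hs.isSelfAdjoint hs.isIdempotentElem hs0
      have hq : IsStarProjection q := ⟨hq2, hq1⟩
      rw [pow_succ]
      by_cases hlt : T q ≤ 1 / 2 * T s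
      · refine ⟨q, hqM, hq, by rw [← hqs, mul_assoc, hsp], hq0, ?_⟩
        linarith
      · refine ⟨s - q, sub_mem hsM hqM, isStarProjection_sub hs hq hqs, ?_,
          sub_ne_zero.2 hqne.symm, ?_⟩
        · rw [sub_mul, hsp]
          nth_rewrite 1 [← hqs]
          rw [mul_assoc, hsp, hqs]
        · rw [map_sub]
          linarith
  have ht : Tendsto (fun N : ℕ => (1 / 2 : ℝ) ^ N * T p) atTop (nhds (0 * T p)) :=
    (tendsto_pow_atTop_nhds_zero_of_lt_one (by norm_num) (by norm_num)).mul_const _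
  rw [zero_mul] at ht
  obtain ⟨N, hN⟩ := (ht.eventually (gt_mem_nhds hε)).exists
  obtain ⟨s, hsM, hs, hsp, hs0, hle⟩ := key N
  exact ⟨s, hsM, hs, hsp, hs0, hle.trans hN.le⟩

/-- Projections of every trace exist. -/
theorem IsTrace.exists_projection_trace_eq (hT : IsTrace M T) (hM : IsFactor M) (hd : IsDiffuse M)
    {c : ℝ} (hc0 : 0 ≤ c) (hc1 : c ≤ 1) : ∃ E ∈ M, IsStarProjection E ∧ T E = c := by
  obtain ⟨F, V, hVM, hF, hV, hFQ, hR, hmax⟩ := exists_maximal_family (M := M)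
    (fun r => r ∈ M ∧ IsStarProjection r)
    (fun r hr => ⟨hr.1, by rw [hr.2.isSelfAdjoint.star_eq, hr.2.isIdempotentElem.eq,
      hr.2.isIdempotentElem.eq]⟩) (fun r => T r ≤ c) (by simpa using hc0)
  have hP : ∀ a ∈ F, IsStarProjection a := fun a ha => (hFQ a ha).2
  obtain ⟨hVP, hVa⟩ := hF.isStarProjection_sum hV hP
  have hfin : ∀ S : Finset (H →L[ℂ] H), ↑S ⊆ F → ∑ a ∈ S, a ∈ M ∧
      IsStarProjection (V - ∑ a ∈ S, a) := by
    intro S hS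
    have h1 := hF.isStarProjection_finset_sum hP S hS
    have h2 : (∑ a ∈ S, a) * V = ∑ a ∈ S, a := by
      have : V * (∑ a ∈ S, a) = ∑ a ∈ S, a := by
        rw [Finset.mul_sum]
        exact Finset.sum_congr rfl fun a ha => hVa a (hS ha)
      simpa only [star_mul, h1.isSelfAdjoint.star_eq, hVP.isSelfAdjoint.star_eq]
        using congrArg star this
    exact ⟨sum_mem fun a ha => (hFQ a (hS ha)).1, isStarProjection_sub hVP h1 h2⟩
  have hVc : T V ≤ c := by
    have h1 : ∀ S : Finset F, V - ∑ a ∈ S.map (Function.Embedding.subtype (· ∈ F)), a ∈ M :=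
      fun S => sub_mem hVM (hfin _ (map_subtype_subset S)).1
    have ht := (hT.tendsto_trace hM h1 fun ξ => by
      rw [tendsto_zero_iff_norm_tendsto_zero]
      have h2 := (tendsto_sum_sub hV ξ).sqrt
      simpa [Real.sqrt_sq] using h2).const_add c
    rw [add_zero] at ht
    refine ge_of_tendsto' ht fun S => ?_
    have h3 := (hfin _ (map_subtype_subset S)).2
    have h4 := hR _ (map_subtype_subset S)
    rw [h3.isSelfAdjoint.star_eq, h3.isIdempotentElem.eq, map_sub]
    linarith
  refine ⟨V, hVM, hVP, hVc.antisymm ?_⟩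
  by_contra! hlt
  have hV1 : (1 : H →L[ℂ] H) - V ≠ 0 := by
    intro h
    rw [← sub_eq_zero.1 h, hT.map_one] at hlt
    linarith
  obtain ⟨s, hsM, hs, hsV, hs0, hsc⟩ := hd.exists_small_projection T
    (sub_mem (one_mem M) hVM) hVP.one_sub hV1 (sub_pos.2 hlt)
  have hsa : ∀ a ∈ F, s * a = 0 := by
    intro a ha
    rw [← hsV, mul_assoc, sub_mul, one_mul, hVa a ha, sub_self, mul_zero]
  have hsF : s ∈ F := hmax s ⟨hsM, hs⟩ (fun a ha => by
    rw [StarOrtho, hs.isSelfAdjoint.star_eq, (hP a ha).isSelfAdjoint.star_eq, hsa a ha]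
    exact ⟨rfl, rfl⟩) fun S hS => by
      have h3 := hfin S hS
      have h4 := hT.nonneg _ (sub_mem hVM h3.1) h3.2.nonneg
      rw [map_sub] at h4
      rw [map_add]
      linarith
  have h2 := hsa s hsF
  rw [hs.isIdempotentElem.eq] at h2
  exact hs0 h2

/-- The first column of a system of `n × n` matrix units in `M`, up to equivalence. -/
theorem IsTrace.exists_column (hT : IsTrace M T) (hM : IsFactor M) (hd : IsDiffuse M) {n : ℕ}
    (hn : 0 < n) : ∃ E ∈ M, IsStarProjection E ∧ T E = 1 / n ∧ ∃ v : Fin n → H →L[ℂ] H,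
      (∀ i, v i ∈ M) ∧ (∀ i j, star (v i) * v j = if i = j then E else 0) ∧
      ∑ i, v i * star (v i) = 1 := by
  have hn' : (0 : ℝ) < n := Nat.cast_pos.2 hn
  obtain ⟨E, hEM, hE, hTE⟩ := hT.exists_projection_trace_eq hM hd (c := 1 / n) (by positivity)
    (by rw [div_le_one hn']; exact_mod_cast hn)
  refine ⟨E, hEM, hE, hTE, ?_⟩
  have hproj : ∀ m, ∀ v : ℕ → H →L[ℂ] H, (∀ i < m, v i ∈ M) →
      (∀ i < m, ∀ j < m, star (v i) * v j = if i = j then E else 0) →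
      ∑ i ∈ Finset.range m, v i * star (v i) ∈ M ∧
      IsStarProjection (∑ i ∈ Finset.range m, v i * star (v i)) ∧
      T (∑ i ∈ Finset.range m, v i * star (v i)) = m / n ∧
      ∀ i < m, star (v i) * (∑ j ∈ Finset.range m, v j * star (v j)) = star (v i) := by
    intro m v hvM hv
    have h0 : ∀ i < m, star (v i) * v i = E := fun i hi => by rw [hv i hi i hi, if_pos rfl]
    have h1 : ∀ i < m, star (v i) * (∑ j ∈ Finset.range m, v j * star (v j)) = star (v i) := by
      intro i hi
      rw [Finset.mul_sum, Finset.sum_eq_single i]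
      · have h2 := congrArg star (mul_eq_self_of_star_mul_self hE (h0 i hi))
        rw [star_mul, hE.isSelfAdjoint.star_eq] at h2
        rw [← mul_assoc, h0 i hi, h2]
      · intro j hj hji
        rw [← mul_assoc, hv i hi j (Finset.mem_range.1 hj), if_neg hji.symm, zero_mul]
      · exact fun h => absurd (Finset.mem_range.2 hi) h
    refine ⟨sum_mem fun i hi => mul_mem (hvM i (Finset.mem_range.1 hi))
      (star_mem (hvM i (Finset.mem_range.1 hi))), ⟨?_, ?_⟩, ?_, h1⟩
    · rw [IsIdempotentElem, Finset.sum_mul]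
      exact Finset.sum_congr rfl fun i hi => by rw [mul_assoc, h1 i (Finset.mem_range.1 hi)]
    · rw [IsSelfAdjoint, star_sum]
      exact Finset.sum_congr rfl fun i _ => by rw [star_mul, star_star]
    · rw [map_sum, Finset.sum_congr rfl fun i hi => by
        rw [hT.mul_star_self_comm (hvM i (Finset.mem_range.1 hi)), h0 i (Finset.mem_range.1 hi),
          hTE]]
      rw [Finset.sum_const, Finset.card_range, nsmul_eq_mul, mul_one_div]
  have key : ∀ m ≤ n, ∃ v : ℕ → H →L[ℂ] H, (∀ i < m, v i ∈ M) ∧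
      ∀ i < m, ∀ j < m, star (v i) * v j = if i = j then E else 0 := by
    intro m
    induction m with
    | zero => exact fun _ => ⟨fun _ => 0, by simp, by simp⟩
    | succ m ih =>
      intro hm
      obtain ⟨v, hvM, hv⟩ := ih (by omega)
      obtain ⟨hPM, hP, hTP, hvP⟩ := hproj m v hvM hv
      set P := ∑ i ∈ Finset.range m, v i * star (v i)
      obtain ⟨w, hwM, hw, hPw⟩ := hT.exists_subequiv hM hEM (sub_mem (one_mem M) hPM) hE hP.one_sub
        (by
          have : ((m + 1 : ℕ) : ℝ) ≤ n := Nat.cast_le.2 hm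
          rw [map_sub, hT.map_one, hTP, hTE, le_sub_iff_add_le, ← add_div, div_le_one hn']
          push_cast at this
          linarith)
      have hvw : ∀ i < m, star (v i) * w = 0 := by
        intro i hi
        rw [← hPw, ← mul_assoc, mul_sub, mul_one, hvP i hi, sub_self, zero_mul]
      have hwv : ∀ i < m, star w * v i = 0 := by
        intro i hi
        simpa only [star_mul, star_star, star_zero] using congrArg star (hvw i hi)
      refine ⟨fun i => if i = m then w else v i, fun i hi => ?_, fun i hi j hj => ?_⟩
      · dsimp only
        split_ifs with h
        · exact hwM
        · exact hvM i (by omega)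
      · dsimp only
        by_cases h1 : i = m <;> by_cases h2 : j = m
        · simp [h1, h2, hw]
        · simp [h1, h2, hwv j (by omega), Ne.symm h2]
        · simp [h1, h2, hvw i (by omega)]
        · simp [h1, h2, hv i (by omega) j (by omega)]
  obtain ⟨v, hvM, hv⟩ := key n le_rfl
  obtain ⟨hPM, hP, hTP, -⟩ := hproj n v hvM hv
  refine ⟨fun i => v i, fun i => hvM i i.2, fun i j => ?_, ?_⟩
  · rw [hv i i.2 j j.2]
    simp [Fin.ext_iff]
  · rw [Finset.sum_range] at hPM hP hTP
    have h1 := hT.eq_zero_of_projection (sub_mem (one_mem M) hPM) hP.one_sub (by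
      rw [map_sub, hT.map_one, hTP, div_self hn'.ne', sub_self])
    exact (sub_eq_zero.1 h1).symm

end MatrixColumn

section MatrixUnits

/-- The family `F i j` is a system of matrix units of the ring `R`. -/
structure IsMatrixUnits {R : Type*} [Ring R] {n : ℕ} (F : Fin n → Fin n → R) : Prop where
  mul : ∀ i j i' j', F i j * F i' j' = if j = i' then F i j' else 0
  sum : ∑ i, F i i = 1

variable {R : Type*} [Ring R] {n : ℕ} {F : Fin n → Fin n → R} {V V' e : R} {c c' : Fin n → R}
  {o : Fin n}

theorem IsMatrixUnits.intertwiner_mul_self (hF : IsMatrixUnits F) (hV : V' * V = e)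
    (hV' : V * V' = F o o) (hee : e * e = e) (hce : ∀ i, c i * e = c i)
    (hc : ∑ i, c i * c' i = 1) :
    (∑ i, c i * (V' * F o i)) * (∑ i, F i o * V * c' i) = 1 := by
  rw [Finset.sum_mul, ← hc]
  refine Finset.sum_congr rfl fun i _ => ?_
  rw [Finset.mul_sum, Finset.sum_eq_single i]
  · calc c i * (V' * F o i) * (F i o * V * c' i) = c i * (V' * (F o i * F i o) * V) * c' i := by
          noncomm_ring
      _ = c i * ((V' * V) * (V' * V)) * c' i := by
          rw [hF.mul, if_pos rfl, ← hV']
          noncomm_ring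
      _ = c i * c' i := by rw [hV, hee, hce]
  · intro j _ hj
    calc c i * (V' * F o i) * (F j o * V * c' j) = c i * (V' * (F o i * F j o) * V) * c' j := by
          noncomm_ring
      _ = 0 := by rw [hF.mul, if_neg (Ne.symm hj)]; noncomm_ring
  · intro h
    exact absurd (Finset.mem_univ i) h

theorem intertwiner_mul (hVe : V * e = V) (hc : ∀ i j, c' i * c j = if i = j then e else 0)
    (j : Fin n) : (∑ i, F i o * V * c' i) * c j = F j o * V := by
  rw [Finset.sum_mul, Finset.sum_eq_single j]
  · rw [mul_assoc, hc, if_pos rfl, mul_assoc, hVe]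
  · intro i _ hi
    rw [mul_assoc, hc, if_neg hi, mul_zero]
  · intro h
    exact absurd (Finset.mem_univ j) h

/-- Matrix units lift along a ring homomorphism along which unitaries lift. -/
theorem IsMatrixUnits.exists_lift {B : Type*} [Ring B] [StarRing B] (π : B →+* R)
    (hπ : ∀ a b, π a = π b → π (star a) = π (star b)) {F : Fin n → Fin n → B}
    (hF : IsMatrixUnits fun i j => π (F i j)) (hFs : ∀ i j, π (star (F i j)) = π (F j i))
    {V e : B} {C : Fin n → B} (hV1 : V * e = V) (hV2 : π (star V * V) = π e)
    (hV4 : π (V * star V) = π (F o o)) (hee : e * e = e) (hCe : ∀ i, C i * e = C i)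
    (hCC : ∀ i j, star (C i) * C j = if i = j then e else 0) (hC1 : ∑ i, C i * star (C i) = 1)
    (hU : ∀ A, π (star A * A) = π 1 → ∃ U, star U * U = 1 ∧ U * star U = 1 ∧ π A = π U) :
    ∃ W : Fin n → B, (∀ i j, star (W i) * W j = if i = j then e else 0) ∧
      (∑ i, W i * star (W i) = 1) ∧ ∀ i j, π (W i * star (W j)) = π (F i j) := by
  rw [map_mul] at hV2 hV4
  have hVe : π V * π e = π V := by
    rw [← map_mul, hV1]
  obtain ⟨A, hA⟩ : ∃ A : B, A = ∑ i, F i o * V * star (C i) := ⟨_, rfl⟩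
  have hA1 : π A =
      ∑ i, π (F i o) * π V * π (star (C i)) := by
    rw [hA, map_sum]
    simp only [map_mul]
  have hA2 : π (star A) =
      ∑ i, π (C i) * (π (star V) * π (F o i)) := by
    rw [hA, star_sum, map_sum]
    simp only [star_mul, star_star, map_mul, hFs]
  have hAA : π (star A * A) = π 1 := by
    rw [map_mul, map_one, hA1, hA2]
    refine hF.intertwiner_mul_self hV2 hV4 (by rw [← map_mul, hee]) (fun i => ?_) ?_
    · rw [← map_mul, hCe]
    · rw [← map_one π, ← hC1, map_sum]
      simp only [map_mul]
  obtain ⟨U, hU1, hU2, hAU⟩ := hU A hAA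
  have hW : ∀ i, π (U * C i) = π (F i o * V) := by
    intro i
    rw [map_mul, ← hAU, hA1, map_mul]
    refine intertwiner_mul (F := fun i j => π (F i j)) (c := fun i => π (C i))
      (c' := fun i => π (star (C i))) hVe (fun i j => ?_) i
    rw [← map_mul, hCC]
    split_ifs
    · rfl
    · exact map_zero _
  refine ⟨fun i => U * C i, fun i j => ?_, ?_, fun i j => ?_⟩
  · rw [star_mul, mul_assoc, ← mul_assoc (star U), hU1, one_mul, hCC]
  · have h1 : ∀ i, (U * C i) * star (U * C i) = U * (C i * star (C i)) * star U := by
      intro i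
      rw [star_mul]
      simp only [mul_assoc]
    simp only [h1]
    rw [← Finset.sum_mul, ← Finset.mul_sum, hC1, mul_one, hU2]
  · rw [map_mul, hW, hπ _ _ (hW j), star_mul, map_mul, map_mul, hFs]
    calc π (F i o) * π V * (π (star V) * π (F o j))
        = π (F i o) * (π V * π (star V)) * π (F o j) := by
          simp only [mul_assoc]
      _ = π (F i j) := by rw [hV4, hF.mul, if_pos rfl, hF.mul, if_pos rfl]

end MatrixUnits

section Lifting

variable {H : Type*} [NormedAddCommGroup H] [InnerProductSpace ℂ H] [CompleteSpace H]
  {M : VonNeumannAlgebra H} {T : (H →L[ℂ] H) →ₗ[ℝ] ℝ} {ι : Type*} {l : Filter ι}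

theorem toUltra_half (hT : IsTrace M T) {a : boundedSeq M ι}
    (hs : toUltra hT l (star a) = toUltra hT l a) : 
    toUltra hT l ((1 / 2 : ℂ) • (a + star a)) = toUltra hT l a := by
  have h1 : (1 / 2 : ℂ) • (a + star a) = (1 / 2 : ℂ) • (1 : boundedSeq M ι) * (a + star a) := by
    rw [smul_mul_assoc, one_mul]
  have h2 : (1 / 2 : ℂ) • (1 : boundedSeq M ι) * (a + a) = a := by
    rw [smul_mul_assoc, one_mul, ← two_smul ℂ, smul_smul]
    norm_num
  rw [h1, map_mul, map_add, hs, ← map_add, ← map_mul, h2]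

theorem IsTrace.exists_projection_lift (hT : IsTrace M T) {a : boundedSeq M ι}
    (hs : toUltra hT l (star a) = toUltra hT l a) (hi : toUltra hT l (a * a) = toUltra hT l a) :
    ∃ p : boundedSeq M ι, (∀ k, IsStarProjection (p.1 k)) ∧ toUltra hT l p = toUltra hT l a := by
  obtain ⟨b, hb⟩ : ∃ b : boundedSeq M ι, b = (1 / 2 : ℂ) • (a + star a) := ⟨_, rfl⟩
  have hba : toUltra hT l b = toUltra hT l a := by
    rw [hb, toUltra_half hT hs]
  have hbs : ∀ k, IsSelfAdjoint (b.1 k) := by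
    intro k
    have h1 : b.1 k = (1 / 2 : ℂ) • (a.1 k + star (a.1 k)) := by rw [hb]; rfl
    rw [h1, IsSelfAdjoint, star_smul, star_add, star_star, add_comm]
    norm_num
  choose p hpM hp hle using fun k => hT.exists_projection_near (b.2.1 k) (hbs k)
  let P : boundedSeq M ι := ⟨p, hpM, 1, fun k => IsStarProjection.norm_le _ (hp k)⟩
  have hle' : ∀ k, T (star (b.1 k - P.1 k) * (b.1 k - P.1 k)) ≤
      4 * T (star ((b * b).1 k - b.1 k) * ((b * b).1 k - b.1 k)) := hle
  have h3 : toUltra hT l (b * b) = toUltra hT l b := by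
    rw [map_mul, hba, ← map_mul, hi]
  have h4 := (toUltra_eq_of_le hT h3 4 hle').symm
  exact ⟨P, hp, h4.trans hba⟩

theorem IsTrace.tendsto_trace_matrixUnit (hT : IsTrace M T) {n : ℕ}
    {F : Fin n → Fin n → boundedSeq M ι}
    (hF : IsMatrixUnits fun i j => toUltra hT l (F i j)) (o : Fin n) :
    Tendsto (fun k => T ((F o o).1 k)) l (nhds (1 / n)) := by
  have hn : (n : ℝ) ≠ 0 := by
    have := o.pos
    positivity
  have h1 : ∀ i, Tendsto (fun k => T ((F i i).1 k) - T ((F o o).1 k)) l (nhds 0) := by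
    intro i
    have h2 : toUltra hT l (F i i) = toUltra hT l (F i o * F o i) := by
      rw [map_mul, hF.mul, if_pos rfl]
    have h3 : toUltra hT l (F o o) = toUltra hT l (F o i * F i o) := by
      rw [map_mul, hF.mul, if_pos rfl]
    have h4 := (tendsto_trace_sub hT h2).sub (tendsto_trace_sub hT h3)
    rw [sub_zero] at h4
    refine h4.congr fun k => ?_
    have h5 : T ((F i o * F o i).1 k) = T ((F o i * F i o).1 k) :=
      hT.map_mul_comm _ ((F i o).2.1 k) _ ((F o i).2.1 k)
    rw [h5]
    ring
  have h2 : toUltra hT l (∑ i, F i i) = toUltra hT l 1 := by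
    rw [map_sum, RingHom.map_one, hF.sum]
  have h3 := (tendsto_trace_sub hT h2).sub (tendsto_finsetSum Finset.univ fun i _ => h1 i)
  have h4 := (h3.add_const 1).div_const (n : ℝ)
  simp only [Finset.sum_const_zero, sub_zero, zero_add] at h4
  refine h4.congr fun k => ?_
  have h5 : T ((∑ i, F i i : boundedSeq M ι).1 k) = ∑ i, T ((F i i).1 k) := by
    rw [← map_sum]
    congr 1
    rw [AddSubmonoidClass.coe_finsetSum, Finset.sum_apply]
  have h6 : T ((1 : boundedSeq M ι).1 k) = 1 := hT.map_one
  rw [h5, h6, Finset.sum_sub_distrib, Finset.sum_const, Finset.card_univ, Fintype.card_fin,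
    nsmul_eq_mul]
  field_simp
  ring

theorem IsTrace.exists_near_equiv (hT : IsTrace M T) (hM : IsFactor M) {E p : H →L[ℂ] H}
    (hEM : E ∈ M) (hpM : p ∈ M) (hE : IsStarProjection E) (hp : IsStarProjection p) :
    ∃ v ∈ M, ‖v‖ ≤ 1 ∧ v * E = v ∧
      T (star (star v * v - E) * (star v * v - E)) ≤ |T p - T E| ∧
      T (star (v * star v - p) * (v * star v - p)) ≤ |T p - T E| := by
  obtain ⟨v, hvM, hv, hpv, hvE, hor⟩ := hM.comparison hEM hpM hE hp
  have hs := isStarProjection_star_mul_self hv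
  have hr := isStarProjection_mul_star_self hv
  have hsM : star v * v ∈ M := mul_mem (star_mem hvM) hvM
  have hrM : v * star v ∈ M := mul_mem hvM (star_mem hvM)
  have h1 : IsStarProjection (E - star v * v) := isStarProjection_sub hE hs (by
    rw [mul_assoc, hvE])
  have h2 : IsStarProjection (p - v * star v) := isStarProjection_sub hp hr (by
    have : p * (v * star v) = v * star v := by rw [← mul_assoc, hpv]
    simpa only [star_mul, star_star, hp.isSelfAdjoint.star_eq] using congrArg star this)
  have h3 := hT.nonneg _ (sub_mem hEM hsM) h1.nonneg
  have h4 := hT.nonneg _ (sub_mem hpM hrM) h2.nonneg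
  have h5 := hT.mul_star_self_comm hvM
  have h6 : T (star (star v * v - E) * (star v * v - E)) = T (E - star v * v) := by
    rw [← neg_sub E, star_neg, neg_mul_neg, h1.isSelfAdjoint.star_eq, h1.isIdempotentElem.eq]
  have h7 : T (star (v * star v - p) * (v * star v - p)) = T (p - v * star v) := by
    rw [← neg_sub p, star_neg, neg_mul_neg, h2.isSelfAdjoint.star_eq, h2.isIdempotentElem.eq]
  refine ⟨v, hvM, norm_le_one_of_idempotent hs.isIdempotentElem, hvE, ?_, ?_⟩
  · rw [h6]
    rw [map_sub] at h3 h4 ⊢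
    rcases hor with h | h
    · rw [h, sub_self]
      exact abs_nonneg _
    · rw [← h5, h, abs_sub_comm]
      exact le_abs_self _
  · rw [h7]
    rw [map_sub] at h3 h4 ⊢
    rcases hor with h | h
    · rw [h5, h]
      exact le_abs_self _
    · rw [h, sub_self]
      exact abs_nonneg _

theorem IsTrace.exists_intertwiner (hT : IsTrace M T) (hM : IsFactor M) {E : H →L[ℂ] H}
    (hEM : E ∈ M) (hE : IsStarProjection E) {p : boundedSeq M ι}
    (hp : ∀ k, IsStarProjection (p.1 k)) (h : Tendsto (fun k => T (p.1 k)) l (nhds (T E))) :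
    ∃ V : boundedSeq M ι, V * constSeq ι E hEM = V ∧
      toUltra hT l (star V * V) = toUltra hT l (constSeq ι E hEM) ∧
      toUltra hT l (V * star V) = toUltra hT l p := by
  have hTp : Tendsto (fun k => |T (p.1 k) - T E|) l (nhds 0) := by
    have h1 := (h.sub_const (T E)).abs
    rwa [sub_self, abs_zero] at h1
  choose v hvM hv1 hvE hv2 hv3 using fun k => hT.exists_near_equiv hM hEM (p.2.1 k) hE (hp k)
  let V : boundedSeq M ι := ⟨v, hvM, 1, hv1⟩
  refine ⟨V, Subtype.ext (funext hvE), ?_, ?_⟩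
  · rw [toUltra_eq_iff]
    exact tendsto_of_tendsto_of_tendsto_of_le_of_le tendsto_const_nhds hTp
      (fun k => hT.nonneg_star_mul_self _
        (sub_mem ((star V * V).2.1 k) ((constSeq ι E hEM).2.1 k))) hv2
  · rw [toUltra_eq_iff]
    exact tendsto_of_tendsto_of_tendsto_of_le_of_le tendsto_const_nhds hTp
      (fun k => hT.nonneg_star_mul_self _ (sub_mem ((V * star V).2.1 k) (p.2.1 k))) hv3

theorem IsTrace.exists_unitary_lift (hT : IsTrace M T) (hM : IsFactor M) {A : boundedSeq M ι}
    (hA : toUltra hT l (star A * A) = toUltra hT l 1) :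
    ∃ U : boundedSeq M ι, star U * U = 1 ∧ U * star U = 1 ∧ toUltra hT l A = toUltra hT l U := by
  choose u huM hu1 hu2 hu3 using fun k => hT.exists_unitary_near hM (A.2.1 k)
  have hun : ∀ k, ‖u k‖ ≤ 1 := fun k => norm_le_one_of_idempotent (by
    rw [hu1]
    exact IsIdempotentElem.one)
  let U : boundedSeq M ι := ⟨u, huM, 1, hun⟩
  have hle : ∀ k, T (star (A.1 k - U.1 k) * (A.1 k - U.1 k)) ≤
      36 * T (star ((star A * A).1 k - (1 : boundedSeq M ι).1 k) *
        ((star A * A).1 k - (1 : boundedSeq M ι).1 k)) := hu3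
  exact ⟨U, Subtype.ext (funext hu1), Subtype.ext (funext hu2), toUltra_eq_of_le hT hA 36 hle⟩

/-- Matrix units of the ultrapower of a diffuse finite factor lift to sequences of exact matrix
units `W i * star (W j)`. -/
theorem IsTrace.exists_matrixUnits_lift (hT : IsTrace M T) (hM : IsFactor M) (hd : IsDiffuse M)
    {n : ℕ} (o : Fin n) {F : Fin n → Fin n → boundedSeq M ι}
    (hF : IsMatrixUnits fun i j => toUltra hT l (F i j))
    (hFs : ∀ i j, toUltra hT l (star (F i j)) = toUltra hT l (F j i)) :
    ∃ (E : H →L[ℂ] H) (hEM : E ∈ M) (W : Fin n → boundedSeq M ι), IsStarProjection E ∧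
      (∀ i j, star (W i) * W j = if i = j then constSeq ι E hEM else 0) ∧
      (∑ i, W i * star (W i) = 1) ∧
      ∀ i j, toUltra hT l (W i * star (W j)) = toUltra hT l (F i j) := by
  obtain ⟨E, hEM, hE, hTE, c, hcM, hcc, hc1⟩ := hT.exists_column hM hd o.pos
  obtain ⟨p, hp, hpF⟩ := hT.exists_projection_lift (hFs o o)
    (by rw [map_mul, hF.mul, if_pos rfl])
  have hTp : Tendsto (fun k => T (p.1 k)) l (nhds (T E)) := by
    have h1 := (tendsto_trace_sub hT hpF).add (hT.tendsto_trace_matrixUnit hF o)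
    rw [zero_add, ← hTE] at h1
    exact h1.congr fun k => sub_add_cancel _ _
  obtain ⟨V, hV1, hV2, hV3⟩ := hT.exists_intertwiner hM hEM hE hp hTp
  let C : Fin n → boundedSeq M ι := fun i => constSeq ι (c i) (hcM i)
  obtain ⟨e, he⟩ : ∃ e : boundedSeq M ι, e = constSeq ι E hEM := ⟨_, rfl⟩
  have hee : e * e = e := by
    rw [he]
    exact Subtype.ext (funext fun _ => hE.isIdempotentElem.eq)
  have hCe : ∀ i, C i * e = C i := by
    intro i
    rw [he]
    exact Subtype.ext (funext fun _ => mul_eq_self_of_star_mul_self hE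
      ((hcc i i).trans (if_pos rfl)))
  have hCC : ∀ i j, star (C i) * C j = if i = j then e else 0 := by
    intro i j
    refine Subtype.ext (funext fun k => (hcc i j).trans ?_)
    rw [he]
    split_ifs
    · rfl
    · rfl
  have hC1 : ∑ i, C i * star (C i) = 1 := by
    refine Subtype.ext (funext fun k => ?_)
    rw [AddSubmonoidClass.coe_finsetSum, Finset.sum_apply]
    exact hc1
  obtain ⟨W, hW1, hW2, hW3⟩ := hF.exists_lift (toUltra hT l) (fun _ _ h => toUltra_star_eq hT h)
    hFs (he ▸ hV1) (he ▸ hV2) (hV3.trans hpF) hee hCe hCC hC1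
    fun _ hA => hT.exists_unitary_lift hM hA
  exact ⟨E, hEM, W, hE, he ▸ hW1, hW2, hW3⟩

end Lifting

section ExactMatrixUnits

variable {H : Type*} [NormedAddCommGroup H] [InnerProductSpace ℂ H] [CompleteSpace H]
  {M : VonNeumannAlgebra H} {n : ℕ} {E : H →L[ℂ] H} {W : Fin n → H →L[ℂ] H}

theorem matrixUnit_mul (hE : IsStarProjection E)
    (hW : ∀ i j, star (W i) * W j = if i = j then E else 0) (i j i' j' : Fin n) :
    (W i * star (W j)) * (W i' * star (W j')) = if j = i' then W i * star (W j') else 0 := by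
  have h1 : W i * E = W i := mul_eq_self_of_star_mul_self hE (by rw [hW, if_pos rfl])
  rw [mul_assoc, ← mul_assoc (star (W j)), hW]
  split_ifs
  · rw [← mul_assoc, h1]
  · rw [zero_mul, mul_zero]

/-- The unital representation of a matrix algebra with matrix units `W i * star (W j)`. -/
noncomputable def matrixHom (hE : IsStarProjection E)
    (hW : ∀ i j, star (W i) * W j = if i = j then E else 0) (h1 : ∑ i, W i * star (W i) = 1) :
    Matrix (Fin n) (Fin n) ℂ →⋆ₐ[ℂ] (H →L[ℂ] H) where
  toFun A := ∑ i, ∑ j, A i j • (W i * star (W j))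
  map_one' := by
    simp only [Matrix.one_apply, ite_smul, one_smul, zero_smul, Finset.sum_ite_eq,
      Finset.mem_univ, if_true, h1]
  map_mul' A B := by
    simp only [Finset.sum_mul, Finset.mul_sum, smul_mul_smul_comm, matrixUnit_mul hE hW,
      Matrix.mul_apply, Finset.sum_smul, smul_ite, smul_zero]
    simp only [Finset.sum_ite_eq', Finset.mem_univ, if_true]
    symm
    refine (Finset.sum_congr rfl fun k _ => Finset.sum_comm).trans (Finset.sum_comm.trans ?_)
    exact Finset.sum_congr rfl fun i _ => Finset.sum_comm
  map_zero' := by simp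
  map_add' A B := by simp only [Matrix.add_apply, add_smul, Finset.sum_add_distrib]
  commutes' r := by
    simp only [Matrix.algebraMap_matrix_apply, ite_smul, zero_smul, Finset.sum_ite_eq,
      Finset.mem_univ, if_true]
    rw [← Finset.smul_sum, h1, Algebra.algebraMap_eq_smul_one]
    simp [Algebra.algebraMap_eq_smul_one]
  map_star' A := by
    simp only [star_sum, star_smul, star_mul, star_star, Matrix.star_apply]
    rw [Finset.sum_comm]

theorem matrixHom_mem (hE : IsStarProjection E)
    (hW : ∀ i j, star (W i) * W j = if i = j then E else 0) (h1 : ∑ i, W i * star (W i) = 1)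
    (hWM : ∀ i, W i ∈ M) (A : Matrix (Fin n) (Fin n) ℂ) : matrixHom hE hW h1 A ∈ M := by
  change ∑ i, ∑ j, A i j • (W i * star (W j)) ∈ M
  exact sum_mem fun i _ => sum_mem fun j _ => smul_mem _ (mul_mem (hWM i) (star_mem (hWM j)))

theorem nDivisible_sum (hE : IsStarProjection E) (hWM : ∀ i, W i ∈ M)
    (hW : ∀ i j, star (W i) * W j = if i = j then E else 0) (h1 : ∑ i, W i * star (W i) = 1)
    (o : Fin n) (x : H →L[ℂ] H) :
    NDivisible M n (∑ m, (W m * star (W o)) * x * (W o * star (W m))) := by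
  refine ⟨matrixHom hE hW h1, fun A => matrixHom_mem hE hW h1 hWM A, fun A => ?_⟩
  refine Commute.sum_left _ _ _ fun i _ => Commute.sum_left _ _ _ fun j _ =>
    Commute.smul_left ?_ _
  rw [Commute, SemiconjBy, Finset.mul_sum, Finset.sum_mul, Finset.sum_eq_single j,
    Finset.sum_eq_single i]
  · rw [mul_assoc (_ * x), matrixUnit_mul hE hW, if_pos rfl, mul_assoc (W j * _), ← mul_assoc,
      matrixUnit_mul hE hW, if_pos rfl, mul_assoc (W i * _)]
  · intro m _ hm
    rw [mul_assoc, matrixUnit_mul hE hW, if_neg hm, mul_zero]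
  · exact fun h => absurd (Finset.mem_univ _) h
  · intro m _ hm
    rw [mul_assoc (W m * _), ← mul_assoc, matrixUnit_mul hE hW, if_neg (Ne.symm hm), zero_mul]
  · exact fun h => absurd (Finset.mem_univ _) h

end ExactMatrixUnits

section SigmaStrong

variable {H : Type*} [NormedAddCommGroup H] [InnerProductSpace ℂ H] {ι : Type*} {l : Filter ι}

theorem sigmaStrongTendsto_of_bounded {y : ι → H →L[ℂ] H} {x : H →L[ℂ] H} {C : ℝ}
    (hC : ∀ k, ‖y k - x‖ ≤ C) (h : ∀ ξ, Tendsto (fun k => (y k - x) ξ) l (nhds 0)) :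
    SigmaStrongTendsto l y x := by
  intro ξ hξ
  have h1 := tendsto_tsum_of_dominated_convergence (𝓕 := l)
    (f := fun k i => ‖y k (ξ i) - x (ξ i)‖ ^ 2) (g := fun _ => (0 : ℝ))
    (bound := fun i => C ^ 2 * ‖ξ i‖ ^ 2) (hξ.mul_left _) (fun i => ?_)
    (Eventually.of_forall fun k i => ?_)
  · rwa [tsum_zero] at h1
  · have h2 := (h (ξ i)).norm.pow 2
    simpa using h2
  · rw [norm_pow, norm_norm, ← mul_pow]
    exact pow_le_pow_left₀ (norm_nonneg _) (((y k - x).le_opNorm (ξ i)).trans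
      (mul_le_mul_of_nonneg_right (hC k) (norm_nonneg _))) 2

theorem tendsto_apply_of_sigmaStrongTendsto {y : ι → H →L[ℂ] H} {x : H →L[ℂ] H}
    (h : SigmaStrongTendsto l y x) (ξ : H) : Tendsto (fun k => (x - y k) ξ) l (nhds 0) := by
  have h1 := h (Pi.single 0 ξ) (summable_of_ne_finset_zero (s := {0}) fun i hi => by
    rw [Pi.single_eq_of_ne (by simpa using hi)]
    simp)
  have h2 : ∀ k, ∑' i, ‖y k ((Pi.single 0 ξ : ℕ → H) i) - x ((Pi.single 0 ξ : ℕ → H) i)‖ ^ 2 =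
      ‖(x - y k) ξ‖ ^ 2 := by
    intro k
    rw [tsum_eq_single 0 fun i hi => by rw [Pi.single_eq_of_ne hi]; simp, Pi.single_eq_same,
      norm_sub_rev]
    rfl
  simp only [h2] at h1
  rw [tendsto_zero_iff_norm_tendsto_zero]
  simpa using h1.sqrt

end SigmaStrong

section Approximation

variable {H : Type*} [NormedAddCommGroup H] [InnerProductSpace ℂ H] [CompleteSpace H]
  {M : VonNeumannAlgebra H} {T : (H →L[ℂ] H) →ₗ[ℝ] ℝ} {ι : Type*} {l : Filter ι}

theorem IsTrace.exists_nDivisible_tendsto (hT : IsTrace M T) (hM : IsFactor M) (hd : IsDiffuse M)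
    {n : ℕ} (o : Fin n) {F : Fin n → Fin n → boundedSeq M ι}
    (hF : IsMatrixUnits fun i j => toUltra hT l (F i j))
    (hFs : ∀ i j, toUltra hT l (star (F i j)) = toUltra hT l (F j i))
    {x : H →L[ℂ] H} (hx : x ∈ M)
    (hcomm : ∀ i j, toUltra hT l (constSeq ι x hx * F i j) =
      toUltra hT l (F i j * constSeq ι x hx)) :
    ∃ y : ι → H →L[ℂ] H, (∀ k, y k ∈ M) ∧ (∀ k, NDivisible M n (y k)) ∧
      SigmaStrongTendsto l y x := by
  obtain ⟨E, hEM, W, hE, hW1, hW2, hW3⟩ := hT.exists_matrixUnits_lift hM hd o hF hFs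
  obtain ⟨X, hX⟩ : ∃ X : boundedSeq M ι, X = ∑ m,
    (W m * star (W o)) * constSeq ι x hx * (W o * star (W m)) := ⟨_, rfl⟩
  have hπX : toUltra hT l X = toUltra hT l (constSeq ι x hx) := by
    have h1 : ∀ m, toUltra hT l ((W m * star (W o)) * constSeq ι x hx * (W o * star (W m))) =
        toUltra hT l (constSeq ι x hx) * toUltra hT l (F m m) := by
      intro m
      rw [map_mul, map_mul, hW3, hW3, ← map_mul, ← hcomm, map_mul, mul_assoc, hF.mul, if_pos rfl]
    rw [hX, map_sum]
    simp only [h1]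
    rw [← Finset.mul_sum, hF.sum, mul_one]
  obtain ⟨C, hC⟩ := (X - constSeq ι x hx).2.2
  have hdiv : ∀ k, NDivisible M n (X.1 k) := by
    intro k
    have h1 : ∀ i j, star ((W i).1 k) * (W j).1 k = if i = j then E else 0 := by
      intro i j
      have h2 := congrArg (fun a : boundedSeq M ι => a.1 k) (hW1 i j)
      refine h2.trans ?_
      split_ifs
      · rfl
      · rfl
    have h2 : ∑ i, (W i).1 k * star ((W i).1 k) = 1 := by
      have h3 := congrArg (fun a : boundedSeq M ι => a.1 k) hW2
      simp only [AddSubmonoidClass.coe_finsetSum, Finset.sum_apply] at h3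
      exact h3
    have h3 := nDivisible_sum (M := M) hE (fun i => (W i).2.1 k) h1 h2 o x
    have h4 : X.1 k = ∑ m, ((W m).1 k * star ((W o).1 k)) * x * ((W o).1 k * star ((W m).1 k)) := by
      rw [hX, AddSubmonoidClass.coe_finsetSum, Finset.sum_apply]
      rfl
    rwa [h4]
  refine ⟨X.1, X.2.1, hdiv, sigmaStrongTendsto_of_bounded hC fun ξ => ?_⟩
  exact hT.tendsto_apply hM (X - constSeq ι x hx).2.1 hC ((toUltra_eq_iff hT).1 hπX) ξ

theorem IsTrace.commutator_le (hT : IsTrace M T) {x y e : H →L[ℂ] H} (hx : x ∈ M) (hy : y ∈ M)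
    (he : e ∈ M) (he1 : ‖e‖ ≤ 1) (hye : Commute e y) :
    T (star (x * e - e * x) * (x * e - e * x)) ≤ 4 * T (star (x - y) * (x - y)) := by
  have hxy := sub_mem hx hy
  have h1 : x * e - e * x = (x - y) * e + -(e * (x - y)) := by
    rw [sub_mul, mul_sub, hye.eq]
    abel
  have h2 := hT.add_le (mul_mem hxy he) (neg_mem (mul_mem he hxy))
  rw [star_neg, neg_mul_neg] at h2
  have h3 := hT.mul_right_le hxy he
  have h4 := hT.mul_left_le hxy he
  have h5 := hT.nonneg_star_mul_self _ hxy
  have h6 : ‖e‖ ^ 2 ≤ 1 := pow_le_one₀ (norm_nonneg _) he1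
  rw [h1]
  nlinarith

theorem IsTrace.exists_matrixUnits (hT : IsTrace M T) {n : ℕ} {x y : H →L[ℂ] H} (hx : x ∈ M)
    (hy : y ∈ M) (h : NDivisible M n y) : ∃ e : Fin n → Fin n → H →L[ℂ] H,
      (∀ i j, e i j ∈ M) ∧ (∀ i j, ‖e i j‖ ≤ 1) ∧ IsMatrixUnits e ∧
      (∀ i j, star (e i j) = e j i) ∧ ∀ i j, T (star (x * e i j - e i j * x) *
        (x * e i j - e i j * x)) ≤ 4 * T (star (x - y) * (x - y)) := by
  obtain ⟨φ, hφM, hφ⟩ := h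
  have hmul : ∀ i j i' j' : Fin n, φ (Matrix.single i j 1) * φ (Matrix.single i' j' 1) =
      if j = i' then φ (Matrix.single i j' 1) else 0 := by
    intro i j i' j'
    rw [← map_mul]
    split_ifs with h
    · rw [h, Matrix.single_mul_single_same, mul_one]
    · rw [Matrix.single_mul_single_of_ne _ _ _ _ h, _root_.map_zero]
  have hstar : ∀ i j : Fin n, star (φ (Matrix.single i j 1)) = φ (Matrix.single j i 1) := by
    intro i j
    rw [← StarHomClass.map_star φ, Matrix.star_eq_conjTranspose,
      Matrix.conjTranspose_single, star_one]
  have hsum : ∑ i, φ (Matrix.single i i 1) = 1 := by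
    rw [← _root_.map_sum, Matrix.sum_single_one, _root_.map_one]
  have hnorm : ∀ i j : Fin n, ‖φ (Matrix.single i j 1)‖ ≤ 1 := fun i j =>
    norm_le_one_of_idempotent (by
      rw [hstar, hmul, if_pos rfl, IsIdempotentElem, hmul, if_pos rfl])
  exact ⟨fun i j => φ (Matrix.single i j 1), fun i j => hφM _, hnorm, ⟨hmul, hsum⟩, hstar,
    fun i j => hT.commutator_le hx hy (hφM _) (hnorm i j) (hφ _)⟩

theorem IsTrace.exists_seq_matrixUnits (hT : IsTrace M T) (hM : IsFactor M) [l.NeBot] {n : ℕ}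
    {x : H →L[ℂ] H} (hx : x ∈ M) {y : ι → H →L[ℂ] H} (hy : ∀ k, y k ∈ M)
    (hdiv : ∀ k, NDivisible M n (y k)) (hlim : SigmaStrongTendsto l y x) :
    ∃ e : ℕ → Fin n → Fin n → H →L[ℂ] H, (∀ k i j, e k i j ∈ M) ∧ (∀ k i j, ‖e k i j‖ ≤ 1) ∧
      (∀ k, IsMatrixUnits (e k)) ∧ (∀ k i j, star (e k i j) = e k j i) ∧
      ∀ i j, Tendsto (fun k => T (star (x * e k i j - e k i j * x) *
        (x * e k i j - e k i j * x))) atTop (nhds 0) := by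
  have h1 := hT.tendsto_trace hM (fun k => sub_mem hx (hy k))
    (tendsto_apply_of_sigmaStrongTendsto hlim)
  have h2 : ∀ k : ℕ, ∃ i, T (star (x - y i) * (x - y i)) < 1 / ((k : ℝ) + 1) := fun k =>
    (h1.eventually_lt_const Nat.one_div_pos_of_nat).exists
  choose s hs using h2
  choose e heM he1 he he2 hle using fun k => hT.exists_matrixUnits hx (hy (s k)) (hdiv (s k))
  refine ⟨e, heM, he1, he, he2, fun i j => ?_⟩
  have h3 := (tendsto_one_div_add_atTop_nhds_zero_nat (𝕜 := ℝ)).const_mul 4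
  rw [mul_zero] at h3
  refine tendsto_of_tendsto_of_tendsto_of_le_of_le tendsto_const_nhds h3 (fun k => ?_) fun k => ?_
  · exact hT.nonneg_star_mul_self _ (sub_mem (mul_mem hx (heM k i j)) (mul_mem (heM k i j) hx))
  · exact (hle k i j).trans (mul_le_mul_of_nonneg_left (hs k).le (by norm_num))

end Approximation

section ComplexTrace

variable {H : Type*} [NormedAddCommGroup H] [InnerProductSpace ℂ H] [CompleteSpace H]
  {M : VonNeumannAlgebra H} {τ : (H →L[ℂ] H) →ₗ[ℂ] ℂ}

theorem re_trace_star (hpos : ∀ a ∈ M, 0 ≤ (τ (star a * a)).re ∧ (τ (star a * a)).im = 0)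
    {a : H →L[ℂ] H} (ha : a ∈ M) : (τ (star a)).re = (τ a).re := by
  have h0 := (hpos a ha).2
  have h2 := (hpos (1 + Complex.I • a) (add_mem (one_mem M) (smul_mem _ ha))).2
  have h3 := (hpos 1 (one_mem M)).2
  simp only [star_add, star_smul, star_one, add_mul, mul_add, mul_one, one_mul, map_add,
    map_smul, smul_mul_smul_comm, smul_eq_mul, Complex.add_im, Complex.mul_im] at h2 h3
  simp [h0, h3] at h2
  linarith

/-- The real part of a trace, as a real-linear functional. -/
noncomputable def reTrace (τ : (H →L[ℂ] H) →ₗ[ℂ] ℂ) : (H →L[ℂ] H) →ₗ[ℝ] ℝ :=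
  Complex.reLm ∘ₗ τ.restrictScalars ℝ

theorem isTrace_reTrace (htr1 : τ 1 = 1) (htrace : ∀ a ∈ M, ∀ b ∈ M, τ (a * b) = τ (b * a))
    (hpos : ∀ a ∈ M, 0 ≤ (τ (star a * a)).re ∧ (τ (star a * a)).im = 0)
    (hfaithful : ∀ a ∈ M, τ (star a * a) = 0 → a = 0) : IsTrace M (reTrace τ) where
  map_one := congrArg Complex.re htr1
  map_mul_comm a ha b hb := congrArg Complex.re (htrace a ha b hb)
  nonneg_star_mul_self a ha := (hpos a ha).1
  eq_zero a ha h := hfaithful a ha (Complex.ext h (hpos a ha).2)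
  map_star _ ha := re_trace_star hpos ha

theorem tendsto_sqrt_iff {ι : Type*} {l : Filter ι} {f : ι → ℝ} (hf : ∀ k, 0 ≤ f k) :
    Tendsto (fun k => Real.sqrt (f k)) l (nhds 0) ↔ Tendsto f l (nhds 0) := by
  refine ⟨fun h => ?_, fun h => by simpa using h.sqrt⟩
  have h1 := h.pow 2
  simpa [Real.sq_sqrt (hf _)] using h1

end ComplexTrace

end TracialDivisibility

/-- Let `M` be a II₁ factor with separable predual (a factor acting on a
separable Hilbert space, with a faithful tracial state `τ`, and diffuse), `ω` a free
ultrafilter on `ℕ`.  For `x ∈ M` and finite `n ≥ 2`, the following are equivalent: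
(a) `x` is a σ-strong limit of `n`-divisible elements of `M`;
(b) `π(x)` is `n`-divisible in the tracial ultrapower `M^ω`, which is encoded intrinsically:
there is a uniformly bounded sequence of approximate `n × n` matrix unit systems in `M`,
satisfying the matrix unit relations, the unit condition and commutation with `x`
asymptotically in `‖·‖₂` along `ω`. -/
theorem stmt19 {H : Type*} [NormedAddCommGroup H] [InnerProductSpace ℂ H] [CompleteSpace H]
    [TopologicalSpace.SeparableSpace H]
    (M : VonNeumannAlgebra H)
    (hfactor : ∀ z ∈ M, (∀ m ∈ M, Commute z m) → ∃ c : ℂ, z = c • (1 : H →L[ℂ] H))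
    (τ : (H →L[ℂ] H) →ₗ[ℂ] ℂ)
    (htr1 : τ 1 = 1)
    (htrace : ∀ a ∈ M, ∀ b ∈ M, τ (a * b) = τ (b * a))
    (hpos : ∀ a ∈ M, 0 ≤ (τ (star a * a)).re ∧ (τ (star a * a)).im = 0)
    (hfaithful : ∀ a ∈ M, τ (star a * a) = 0 → a = 0)
    (hdiffuse : ∀ p ∈ M, IsSelfAdjoint p → IsIdempotentElem p → p ≠ 0 →
      ∃ q ∈ M, IsSelfAdjoint q ∧ IsIdempotentElem q ∧ q * p = q ∧ q ≠ 0 ∧ q ≠ p)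
    (ω : Ultrafilter ℕ) (hfree : (ω : Filter ℕ) ≤ Filter.cofinite)
    (n : ℕ) (hn : 2 ≤ n)
    (x : H →L[ℂ] H) (hx : x ∈ M) :
    (∃ (ι : Type) (l : Filter ι), l.NeBot ∧
      ∃ xs : ι → H →L[ℂ] H, (∀ α, xs α ∈ M) ∧ (∀ α, NDivisible M n (xs α)) ∧
        SigmaStrongTendsto l xs x) ↔
    (∃ (C : ℝ) (e : ℕ → Fin n → Fin n → (H →L[ℂ] H)),
      (∀ k i j, e k i j ∈ M) ∧ (∀ k i j, ‖e k i j‖ ≤ C) ∧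
      (∀ i j i' j', Tendsto
        (fun k => Real.sqrt (τ (star (e k i j * e k i' j' -
          (if j = i' then e k i j' else 0)) *
            (e k i j * e k i' j' - (if j = i' then e k i j' else 0)))).re)
        ω (nhds 0)) ∧
      (∀ i j, Tendsto
        (fun k => Real.sqrt (τ (star (star (e k i j) - e k j i) *
          (star (e k i j) - e k j i))).re) ω (nhds 0)) ∧
      (Tendsto (fun k => Real.sqrt
        (τ (star ((∑ i, e k i i) - 1) * ((∑ i, e k i i) - 1))).re) ω (nhds 0)) ∧
      (∀ i j, Tendsto (fun k => Real.sqrt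
        (τ (star (x * e k i j - e k i j * x) * (x * e k i j - e k i j * x))).re)
        ω (nhds 0))) := by
  have hT : TracialDivisibility.IsTrace M (TracialDivisibility.reTrace τ) :=
    TracialDivisibility.isTrace_reTrace htr1 htrace hpos hfaithful
  have o : Fin n := ⟨0, by omega⟩
  constructor
  · rintro ⟨ι, l, hl, y, hyM, hdiv, hlim⟩
    obtain ⟨e, heM, he1, he, hes, hcomm⟩ := hT.exists_seq_matrixUnits hfactor hx hyM hdiv hlim
    refine ⟨1, e, heM, he1, fun i j i' j' => ?_, fun i j => ?_, ?_, fun i j => ?_⟩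
    · simp [(he _).mul]
    · simp [hes]
    · simp [(he _).sum]
    · refine (TracialDivisibility.tendsto_sqrt_iff fun k => (hpos _ (sub_mem
        (mul_mem hx (heM k i j)) (mul_mem (heM k i j) hx))).1).2 ((hcomm i j).mono_left ?_)
      exact hfree.trans Nat.cofinite_eq_atTop.le
  · rintro ⟨C, e, heM, heC, hmul, hstar, hsum, hcomm⟩
    let F : Fin n → Fin n → TracialDivisibility.boundedSeq M ℕ := fun i j =>
      ⟨fun k => e k i j, fun k => heM k i j, C, fun k => heC k i j⟩
    have key : ∀ a b : TracialDivisibility.boundedSeq M ℕ, Tendsto (fun k => Real.sqrt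
        (τ (star (a.1 k - b.1 k) * (a.1 k - b.1 k))).re) ω (nhds 0) →
        TracialDivisibility.toUltra hT (ω : Filter ℕ) a =
          TracialDivisibility.toUltra hT (ω : Filter ℕ) b := fun a b h =>
      (TracialDivisibility.toUltra_eq_iff hT).2 ((TracialDivisibility.tendsto_sqrt_iff fun k =>
        (hpos _ (sub_mem (a.2.1 k) (b.2.1 k))).1).1 h)
    have hF : TracialDivisibility.IsMatrixUnits fun i j =>
        TracialDivisibility.toUltra hT (ω : Filter ℕ) (F i j) := by
      refine ⟨fun i j i' j' => ?_, ?_⟩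
      · rw [← map_mul]
        have h := hmul i j i' j'
        split_ifs at h ⊢ with hj
        · exact key (F i j * F i' j') (F i j') h
        · rw [← RingHom.map_zero (TracialDivisibility.toUltra hT (ω : Filter ℕ))]
          exact key (F i j * F i' j') 0 h
      · rw [← map_sum, ← RingHom.map_one (TracialDivisibility.toUltra hT (ω : Filter ℕ))]
        refine key (∑ i, F i i) 1 ?_
        simp only [AddSubmonoidClass.coe_finsetSum, Finset.sum_apply]
        exact hsum
    have hxF : ∀ i j, TracialDivisibility.toUltra hT (ω : Filter ℕ)
        (TracialDivisibility.constSeq ℕ x hx * F i j) =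
        TracialDivisibility.toUltra hT (ω : Filter ℕ)
          (F i j * TracialDivisibility.constSeq ℕ x hx) :=
      fun i j => key _ _ (hcomm i j)
    obtain ⟨y, hyM, hdiv, hlim⟩ := hT.exists_nDivisible_tendsto hfactor hdiffuse o hF
      (fun i j => key (star (F i j)) (F j i) (hstar i j)) hx hxF
    exact ⟨ℕ, ω, ω.neBot, y, hyM, hdiv, hlim⟩
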